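/- arXiv:1605.04234 — 5 statements merged into one kernel-verified Lean document; each statement's English description precedes it below -/
import Mathlib

section
/- For any real analytic, positive, 1-periodic functions Λ₁, Λ₂: ℝ → ℝ with Λ₁ nonconstant, and any ε > 0, there exist real analytic doubly periodic functions Λ, u₀, f, g: ℝ² → ℝ with Λ > 0 everywhere, satisfying system (9), such that g_x − f_y is not identically zero (i.e. the magnetic field Ω = (1/4)(g_x − f_y) is not identically zero) and sup_{(x,y)} |Λ(x,y) − (Λ₁(x)+Λ₂(y))| < ε, sup |u₀(x,y) − (2Λ₂(y)−2Λ₁(x))| < ε, sup |f| < ε, sup |g| < ε. -/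
open Set

/-- Partial derivative in the first variable. -/
noncomputable def pX (h : ℝ × ℝ → ℝ) (p : ℝ × ℝ) : ℝ := fderiv ℝ h p (1, 0)

/-- Partial derivative in the second variable. -/
noncomputable def pY (h : ℝ × ℝ → ℝ) (p : ℝ × ℝ) : ℝ := fderiv ℝ h p (0, 1)

/-- A function on `ℝ²` is doubly periodic if it is `1`-periodic in each variable. -/
def DoublyPeriodic (h : ℝ × ℝ → ℝ) : Prop :=
  ∀ x y : ℝ, h (x + 1, y) = h (x, y) ∧ h (x, y + 1) = h (x, y)

/-- System (9) of the paper, for functions `Λ, u₀, f, g : ℝ² → ℝ`. -/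
def System9 (Λ u₀ f g : ℝ × ℝ → ℝ) : Prop :=
  ∀ p : ℝ × ℝ,
    pX f p + pY g p = 0 ∧
    pX (fun q => f q * Λ q) p - pY (fun q => g q * Λ q) p = 0 ∧
    pX u₀ p + 2 * pX Λ p - (1/2) * g p * (pY f p - pX g p) = 0 ∧
    -(pY u₀ p) + 2 * pY Λ p + (1/2) * f p * (pY f p - pX g p) = 0

namespace MagneticTorus

open scoped Real ENNReal PowerSeries

open Complex in
/-- The exponent `p ↦ 2πi (k₁ p₁ + k₂ p₂)` of the character with frequency `k`. -/
noncomputable def phase (k : ℤ × ℤ) : ℝ × ℝ →L[ℝ] ℂ :=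
  (2 * π * I * k.1 : ℂ) • (ofRealCLM.comp (ContinuousLinearMap.fst ℝ ℝ ℝ)) +
    (2 * π * I * k.2 : ℂ) • (ofRealCLM.comp (ContinuousLinearMap.snd ℝ ℝ ℝ))

open Complex in
lemma phase_apply (k : ℤ × ℤ) (v : ℝ × ℝ) :
    phase k v = (2 * π * (k.1 * v.1 + k.2 * v.2) : ℝ) * I := by
  simp [phase]
  ring

lemma phase_add (k l : ℤ × ℤ) (v : ℝ × ℝ) : phase (k + l) v = phase k v + phase l v := by
  simp only [phase_apply, Prod.fst_add, Prod.snd_add]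
  push_cast
  ring

lemma phase_zero (v : ℝ × ℝ) : phase 0 v = 0 := by
  simp [phase_apply]

/-- The size of a frequency. -/
noncomputable def freq (k : ℤ × ℤ) : ℝ := 2 * π * (|(k.1 : ℝ)| + |(k.2 : ℝ)|)

lemma freq_nonneg (k : ℤ × ℤ) : 0 ≤ freq k := by
  unfold freq
  positivity

lemma freq_add_le (k l : ℤ × ℤ) : freq (k + l) ≤ freq k + freq l := by
  unfold freq
  rw [← mul_add]
  refine mul_le_mul_of_nonneg_left ?_ (by positivity)
  have h₁ := abs_add_le (k.1 : ℝ) (l.1 : ℝ)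
  have h₂ := abs_add_le (k.2 : ℝ) (l.2 : ℝ)
  push_cast [Prod.fst_add, Prod.snd_add]
  linarith

lemma norm_phase_apply_le (k : ℤ × ℤ) (v : ℝ × ℝ) : ‖phase k v‖ ≤ freq k * ‖v‖ := by
  rw [phase_apply, norm_mul, Complex.norm_I, mul_one, Complex.norm_real, Real.norm_eq_abs,
    abs_mul, abs_of_pos Real.two_pi_pos, freq, mul_assoc (2 * π)]
  refine mul_le_mul_of_nonneg_left ?_ Real.two_pi_pos.le
  have h₁ : |v.1| ≤ ‖v‖ := norm_fst_le v
  have h₂ : |v.2| ≤ ‖v‖ := norm_snd_le v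
  calc |(k.1 : ℝ) * v.1 + k.2 * v.2| ≤ |(k.1 : ℝ)| * |v.1| + |(k.2 : ℝ)| * |v.2| := by
        rw [← abs_mul, ← abs_mul]
        exact abs_add_le _ _
    _ ≤ |(k.1 : ℝ)| * ‖v‖ + |(k.2 : ℝ)| * ‖v‖ := by gcongr
    _ = _ := by ring

lemma norm_phase_le (k : ℤ × ℤ) : ‖phase k‖ ≤ freq k :=
  ContinuousLinearMap.opNorm_le_bound _ (freq_nonneg k) (norm_phase_apply_le k)

lemma norm_exp_phase (k : ℤ × ℤ) (p : ℝ × ℝ) : ‖Complex.exp (phase k p)‖ = 1 := by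
  rw [phase_apply, Complex.norm_exp_ofReal_mul_I]

/-- Trigonometric polynomials on the torus, as formal combinations of characters. -/
abbrev TrigPoly := AddMonoidAlgebra ℂ (ℤ × ℤ)

namespace TrigPoly

/-- The value of a trigonometric polynomial at a point. -/
noncomputable def eval (p : ℝ × ℝ) : TrigPoly →ₐ[ℂ] ℂ :=
  AddMonoidAlgebra.lift ℂ ℂ (ℤ × ℤ)
    { toFun := fun k => Complex.exp (phase k.toAdd p)
      map_one' := by simp [phase_zero]
      map_mul' := fun k l => by simp [phase_add, Complex.exp_add] }

lemma eval_single (p : ℝ × ℝ) (k : ℤ × ℤ) (c : ℂ) :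
    eval p (AddMonoidAlgebra.single k c) = c * Complex.exp (phase k p) := by
  simp [eval]

lemma eval_eq_tsum (p : ℝ × ℝ) (r : TrigPoly) :
    eval p r = ∑' k, r.coeff k * Complex.exp (phase k p) := by
  rw [tsum_eq_sum (s := r.coeff.support)]
  · simp [eval, AddMonoidAlgebra.lift_apply, Finsupp.sum]
  · intro k hk
    simp [Finsupp.notMem_support_iff.1 hk]

/-- The directional derivative of a trigonometric polynomial. -/
noncomputable def deriv (v : ℝ × ℝ) : TrigPoly →+ TrigPoly where
  toFun r := .ofCoeff ((fun k => phase k v) • r.coeff)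
  map_zero' := by ext; simp
  map_add' r s := by ext; simp

lemma coeff_deriv (v : ℝ × ℝ) (r : TrigPoly) (k : ℤ × ℤ) :
    (deriv v r).coeff k = phase k v * r.coeff k := rfl

lemma deriv_single (v : ℝ × ℝ) (k : ℤ × ℤ) (c : ℂ) :
    deriv v (AddMonoidAlgebra.single k c) = AddMonoidAlgebra.single k (phase k v * c) := by
  classical
  ext l
  rw [coeff_deriv]
  by_cases h : k = l <;> simp [AddMonoidAlgebra.coeff_single, h]

lemma deriv_smul (v : ℝ × ℝ) (c : ℂ) (r : TrigPoly) : deriv v (c • r) = c • deriv v r := by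
  ext k
  simp only [coeff_deriv, AddMonoidAlgebra.coeff_smul_apply, smul_eq_mul]
  ring

lemma deriv_comm (v w : ℝ × ℝ) (r : TrigPoly) : deriv v (deriv w r) = deriv w (deriv v r) := by
  ext k
  simp only [coeff_deriv]
  ring

lemma deriv_mul (v : ℝ × ℝ) (r s : TrigPoly) :
    deriv v (r * s) = r * deriv v s + deriv v r * s := by
  induction r using AddMonoidAlgebra.induction_linear with
  | zero => simp
  | add r₁ r₂ h₁ h₂ => rw [add_mul, map_add, h₁, h₂, map_add]; ring
  | single k c =>
    induction s using AddMonoidAlgebra.induction_linear with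
    | zero => simp
    | add s₁ s₂ h₁ h₂ => rw [mul_add, map_add, h₁, h₂, map_add]; ring
    | single l d =>
      simp only [AddMonoidAlgebra.single_mul_single, deriv_single, phase_add,
        ← AddMonoidAlgebra.single_add]
      congr 1
      ring

lemma hasDerivAt_eval (p v : ℝ × ℝ) (r : TrigPoly) (s : ℝ) :
    HasDerivAt (fun s : ℝ => eval (p + s • v) r) (eval (p + s • v) (deriv v r)) s := by
  induction r using AddMonoidAlgebra.induction_linear with
  | zero => simpa using hasDerivAt_const s (0 : ℂ)
  | add r₁ r₂ h₁ h₂ => simpa [Pi.add_def] using h₁.add h₂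
  | single k c =>
    simp only [deriv_single, eval_single]
    have h : HasDerivAt (fun s : ℝ => p + s • v) v s := by
      simpa using ((hasDerivAt_id s).smul_const v).const_add p
    have h' := (((phase k).hasFDerivAt.comp_hasDerivAt s h).cexp).const_mul c
    have e : phase k v * c * Complex.exp (phase k (p + s • v)) =
        c * (Complex.exp (phase k (p + s • v)) * phase k v) := by ring
    rw [e]
    exact h'

/-- A trigonometric polynomial is real if all its values are. -/
def IsReal (r : TrigPoly) : Prop := ∀ p, (eval p r).im = 0

lemma IsReal.add {r s : TrigPoly} (hr : IsReal r) (hs : IsReal s) : IsReal (r + s) := fun p => by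
  simp [hr p, hs p]

lemma IsReal.sub {r s : TrigPoly} (hr : IsReal r) (hs : IsReal s) : IsReal (r - s) := fun p => by
  simp [hr p, hs p]

lemma IsReal.mul {r s : TrigPoly} (hr : IsReal r) (hs : IsReal s) : IsReal (r * s) := fun p => by
  simp [hr p, hs p]

lemma IsReal.neg {r : TrigPoly} (hr : IsReal r) : IsReal (-r) := fun p => by
  simp [hr p]

lemma isReal_zero : IsReal 0 := fun p => by simp

lemma IsReal.sum {ι : Type*} {s : Finset ι} {r : ι → TrigPoly} (h : ∀ i ∈ s, IsReal (r i)) :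
    IsReal (∑ i ∈ s, r i) := fun p => by
  rw [map_sum, Complex.im_sum]
  exact Finset.sum_eq_zero fun i hi => h i hi p

lemma IsReal.smul {r : TrigPoly} (hr : IsReal r) (c : ℝ) : IsReal ((c : ℂ) • r) := fun p => by
  rw [map_smul, smul_eq_mul, Complex.im_ofReal_mul, hr p, mul_zero]

lemma IsReal.deriv {r : TrigPoly} (hr : IsReal r) (v : ℝ × ℝ) : IsReal (deriv v r) := fun p => by
  have h := Complex.imCLM.hasFDerivAt.comp_hasDerivAt 0 (hasDerivAt_eval p v r 0)
  have h' : (Complex.imCLM ∘ fun s : ℝ => eval (p + s • v) r) = fun _ => 0 := by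
    ext s
    exact hr _
  rw [h'] at h
  simpa using h.unique (hasDerivAt_const 0 0)

end TrigPoly

section Compatibility

variable {A : Type*} [CommRing A] {dt dx dy : A →+ A}

/-- The flow `f_t = 2u_y`, `g_t = -2u_x`, `Λ_t = (gΛ)_x + (fΛ)_y`,
`u_t = 2(fΛ)_y - 2(gΛ)_x + f u_y + g u_x` propagates the equations of the magnetic geodesic
system: their defects satisfy a linear homogeneous evolution system. -/
lemma defect_evolution
    (ht : ∀ a b, dt (a * b) = a * dt b + dt a * b) (hx : ∀ a b, dx (a * b) = a * dx b + dx a * b)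
    (hy : ∀ a b, dy (a * b) = a * dy b + dy a * b)
    (htx : ∀ a, dt (dx a) = dx (dt a)) (hty : ∀ a, dt (dy a) = dy (dt a))
    (hyx : ∀ a, dy (dx a) = dx (dy a)) {f g l u E₂ E₃ E₄ : A}
    (hf : dt f = 2 * dy u) (hg : dt g = -(2 * dx u)) (hl : dt l = dx (g * l) + dy (f * l))
    (hu : dt u = 2 * dy (f * l) - 2 * dx (g * l) + f * dy u + g * dx u)
    (h₁ : dx f + dy g = 0) (h₂ : E₂ = dx (f * l) - dy (g * l))
    (h₃ : E₃ = 2 * dx u + 4 * dx l - g * (dy f - dx g))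
    (h₄ : E₄ = -(2 * dy u) + 4 * dy l + f * (dy f - dx g)) :
    dt E₂ = dx (g * E₂ - l * E₄) + dy (f * E₂ + l * E₃) ∧
    dt E₃ = dy (4 * E₂ + f * E₃ + g * E₄) ∧
    dt E₄ = dx (f * E₃ + g * E₄ - 4 * E₂) := by
  have h₁x : dx (dx f) + dx (dy g) = 0 := by rw [← map_add, h₁, map_zero]
  have h₁y : dx (dy f) + dy (dy g) = 0 := by rw [← hyx, ← map_add, h₁, map_zero]
  have two_mul' : ∀ (d : A →+ A) (a : A), d (2 * a) = 2 * d a := fun d a => by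
    rw [two_mul, map_add, two_mul]
  have four_mul' : ∀ (d : A →+ A) (a : A), d (4 * a) = 4 * d a := fun d a => by
    rw [show (4 : A) = 2 * 2 by norm_num, mul_assoc, two_mul', two_mul', mul_assoc]
  subst h₂ h₃ h₄
  refine ⟨?_, ?_, ?_⟩
  · simp only [map_add, map_sub, map_neg, two_mul', four_mul', ht, hx, hy, htx, hty, hyx, hf, hg,
      hl]
    linear_combination (-(g * dx l + dx g * l) + (f * dy l + dy f * l)) * h₁ - g * l * h₁x +
      f * l * h₁y
  · simp only [map_add, map_sub, map_neg, two_mul', four_mul', ht, hx, hy, htx, hty, hyx, hf, hg,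
      hl, hu]
    linear_combination (2 * dy u + 4 * dy l) * h₁ + 4 * l * h₁y
  · simp only [map_add, map_sub, map_neg, two_mul', four_mul', ht, hx, hy, htx, hty, hyx, hf, hg,
      hl, hu]
    linear_combination (4 * dx l - 2 * dx u) * h₁ + 4 * l * h₁x

end Compatibility

/-- Formal power series in the time variable with trigonometric polynomials as coefficients. -/
abbrev Series := PowerSeries TrigPoly

namespace Series

open PowerSeries

/-- The coefficientwise directional derivative. -/
noncomputable def space (v : ℝ × ℝ) : Series →+ Series where
  toFun a := mk fun n => TrigPoly.deriv v (coeff n a)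
  map_zero' := by ext1 n; simp
  map_add' a b := by ext1 n; simp

@[simp]
lemma coeff_space (v : ℝ × ℝ) (a : Series) (n : ℕ) :
    coeff n (space v a) = TrigPoly.deriv v (coeff n a) := by
  simp [space]

lemma space_mul (v : ℝ × ℝ) (a b : Series) : space v (a * b) = a * space v b + space v a * b := by
  ext1 n
  simp [coeff_mul, TrigPoly.deriv_mul, Finset.sum_add_distrib]

lemma space_comm (v w : ℝ × ℝ) (a : Series) : space v (space w a) = space w (space v a) := by
  ext1 n
  simp [TrigPoly.deriv_comm v w]

lemma space_two_mul (v : ℝ × ℝ) (a : Series) : space v (2 * a) = 2 * space v a := by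
  rw [two_mul, map_add, two_mul]

lemma space_C (v : ℝ × ℝ) (r : TrigPoly) : space v (C r) = C (TrigPoly.deriv v r) := by
  ext1 n
  rw [coeff_space, coeff_C, coeff_C]
  split_ifs <;> simp

/-- The formal time derivative. -/
noncomputable def time : Series →+ Series := (derivative TrigPoly).toLinearMap.toAddMonoidHom

lemma coeff_time (a : Series) (n : ℕ) : coeff n (time a) = coeff (n + 1) a * (n + 1) :=
  coeff_derivative a n

lemma time_mul (a b : Series) : time (a * b) = a * time b + time a * b := by
  rw [mul_comm (time a)]
  exact (derivative TrigPoly).leibniz a b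

lemma time_space (v : ℝ × ℝ) (a : Series) : time (space v a) = space v (time a) := by
  ext1 n
  rw [coeff_time, coeff_space, coeff_space, coeff_time, TrigPoly.deriv_mul]
  have h : TrigPoly.deriv v ((n : TrigPoly) + 1) = 0 := by
    have h₁ : TrigPoly.deriv v 1 = 0 := by
      simpa using TrigPoly.deriv_mul v 1 1
    rw [map_add, h₁, add_zero, ← nsmul_one n, map_nsmul, h₁, smul_zero]
  rw [h, mul_zero, zero_add]

/-- The formal primitive in time without constant term. -/
noncomputable def prim : Series →+ Series where
  toFun a := mk fun n => (n : ℂ)⁻¹ • coeff (n - 1) a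
  map_zero' := by ext1 n; simp
  map_add' a b := by ext1 n; simp

lemma coeff_prim (a : Series) (n : ℕ) : coeff n (prim a) = (n : ℂ)⁻¹ • coeff (n - 1) a := by
  simp [prim]

@[simp]
lemma coeff_zero_prim (a : Series) : coeff 0 (prim a) = 0 := by
  simp [coeff_prim]

lemma coeff_succ_prim (a : Series) (n : ℕ) :
    coeff (n + 1) (prim a) = ((n : ℂ) + 1)⁻¹ • coeff n a := by
  simp [coeff_prim]

lemma natCast_add_one_mul (r : TrigPoly) (n : ℕ) : r * (n + 1) = ((n : ℂ) + 1) • r := by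
  rw [add_smul, one_smul, Nat.cast_smul_eq_nsmul, nsmul_eq_mul]
  ring

lemma time_prim (a : Series) : time (prim a) = a := by
  ext1 n
  rw [coeff_time, coeff_succ_prim, natCast_add_one_mul, smul_smul,
    mul_inv_cancel₀ (Nat.cast_add_one_ne_zero n), one_smul]

lemma prim_time {a : Series} (h : coeff 0 a = 0) : prim (time a) = a := by
  ext1 n
  cases n with
  | zero => rw [coeff_zero_prim, h]
  | succ n =>
    rw [coeff_succ_prim, coeff_time, natCast_add_one_mul, smul_smul,
      inv_mul_cancel₀ (Nat.cast_add_one_ne_zero n), one_smul]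

lemma space_prim (v : ℝ × ℝ) (a : Series) : space v (prim a) = prim (space v a) := by
  ext1 n
  simp [coeff_prim, TrigPoly.deriv_smul]

lemma X_pow_dvd_space {n : ℕ} {a : Series} (v : ℝ × ℝ) (h : X ^ n ∣ a) : X ^ n ∣ space v a := by
  rw [X_pow_dvd_iff] at h ⊢
  intro m hm
  simp [h m hm]

lemma X_pow_succ_dvd_prim {n : ℕ} {a : Series} (h : X ^ n ∣ a) : X ^ (n + 1) ∣ prim a := by
  rw [X_pow_dvd_iff] at h ⊢
  intro m hm
  cases m with
  | zero => simp
  | succ m => rw [coeff_succ_prim, h m (by omega), smul_zero]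

lemma eq_zero_of_X_pow_dvd {a : Series} (h : ∀ n : ℕ, X ^ n ∣ a) : a = 0 := by
  ext1 n
  simpa using X_pow_dvd_iff.1 (h (n + 1)) n (by omega)

/-- A self-map of tuples of power series that improves `X`-adic congruences has a fixed point,
the limit of its iterates. -/
lemma exists_fixedPoint {ι : Type*} {F : (ι → Series) → ι → Series}
    (hF : ∀ (n : ℕ) (U V : ι → Series), (∀ i, X ^ n ∣ U i - V i) →
      ∀ i, X ^ (n + 1) ∣ F U i - F V i) (U₀ : ι → Series) :
    ∃ U, F U = U ∧ ∀ (n : ℕ) (i : ι), X ^ n ∣ U i - F^[n] U₀ i := by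
  have step : ∀ (n : ℕ) (i : ι), X ^ n ∣ F^[n + 1] U₀ i - F^[n] U₀ i := by
    intro n
    induction n with
    | zero => simp
    | succ n ih =>
      intro i
      rw [Function.iterate_succ_apply' F (n + 1), Function.iterate_succ_apply' F n]
      rw [Function.iterate_succ_apply'] at ih
      exact hF n _ _ ih i
  have stable : ∀ (n k : ℕ) (i : ι), X ^ n ∣ F^[n + k] U₀ i - F^[n] U₀ i := by
    intro n k i
    induction k with
    | zero => simp
    | succ k ih =>
      have h := ((pow_dvd_pow X (Nat.le_add_right n k)).trans (step (n + k) i)).add ih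
      rwa [sub_add_sub_cancel] at h
  let U : ι → Series := fun i => mk fun n => coeff n (F^[n + 1] U₀ i)
  have hU : ∀ (n : ℕ) (i : ι), X ^ n ∣ U i - F^[n] U₀ i := by
    intro n i
    rw [X_pow_dvd_iff]
    intro m hm
    obtain ⟨k, rfl⟩ : ∃ k, n = m + 1 + k := ⟨n - (m + 1), by omega⟩
    have h := X_pow_dvd_iff.1 (stable (m + 1) k i) m (by omega)
    rw [map_sub, sub_eq_zero] at h
    simp [U, h]
  refine ⟨U, funext fun i => ?_, hU⟩
  rw [← sub_eq_zero]
  refine eq_zero_of_X_pow_dvd fun n => (pow_dvd_pow X (Nat.le_succ n)).trans ?_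
  have h := (hF n U (F^[n] U₀) (hU n) i).sub (hU (n + 1) i)
  rw [Function.iterate_succ_apply'] at h
  rwa [sub_sub_sub_cancel_right] at h

lemma eq_zero_of_linear_evolution {f g l E₂ E₃ E₄ : Series} {v w : ℝ × ℝ}
    (h₂ : time E₂ = space v (g * E₂ - l * E₄) + space w (f * E₂ + l * E₃))
    (h₃ : time E₃ = space w (4 * E₂ + f * E₃ + g * E₄))
    (h₄ : time E₄ = space v (f * E₃ + g * E₄ - 4 * E₂))
    (h₂' : coeff 0 E₂ = 0) (h₃' : coeff 0 E₃ = 0) (h₄' : coeff 0 E₄ = 0) :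
    E₂ = 0 ∧ E₃ = 0 ∧ E₄ = 0 := by
  have key : ∀ n : ℕ, X ^ n ∣ E₂ ∧ X ^ n ∣ E₃ ∧ X ^ n ∣ E₄ := by
    intro n
    induction n with
    | zero => simp
    | succ n ih =>
      obtain ⟨i₂, i₃, i₄⟩ := ih
      rw [← prim_time h₂', ← prim_time h₃', ← prim_time h₄', h₂, h₃, h₄]
      refine ⟨X_pow_succ_dvd_prim ((X_pow_dvd_space _ ?_).add (X_pow_dvd_space _ ?_)),
        X_pow_succ_dvd_prim (X_pow_dvd_space _ ?_), X_pow_succ_dvd_prim (X_pow_dvd_space _ ?_)⟩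
      · exact (i₂.mul_left _).sub (i₄.mul_left _)
      · exact (i₂.mul_left _).add (i₃.mul_left _)
      · exact ((i₂.mul_left _).add (i₃.mul_left _)).add (i₄.mul_left _)
      · exact ((i₃.mul_left _).add (i₄.mul_left _)).sub (i₂.mul_left _)
  exact ⟨eq_zero_of_X_pow_dvd fun n => (key n).1, eq_zero_of_X_pow_dvd fun n => (key n).2.1,
    eq_zero_of_X_pow_dvd fun n => (key n).2.2⟩

end Series

/-- The weight of the monomial `tⁿ e_k`: the supremum over `s ∈ [0, 1]` of its size at time `τ s`
on the strip of width `2 - s`. -/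
noncomputable def weight (τ : ℝ) (n : ℕ) (k : ℤ × ℤ) : ℝ≥0∞ :=
  ⨆ s : Icc (0 : ℝ) 1, ENNReal.ofReal ((τ * s) ^ n * Real.exp ((2 - s) * freq k))

lemma le_weight_of_mem {τ s : ℝ} (hs : s ∈ Icc (0 : ℝ) 1) (n : ℕ) (k : ℤ × ℤ) :
    ENNReal.ofReal ((τ * s) ^ n * Real.exp ((2 - s) * freq k)) ≤ weight τ n k :=
  le_iSup (fun s : Icc (0 : ℝ) 1 =>
    ENNReal.ofReal ((τ * s) ^ n * Real.exp ((2 - s) * freq k))) ⟨s, hs⟩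

lemma le_weight (τ : ℝ) (n : ℕ) (k : ℤ × ℤ) :
    ENNReal.ofReal (τ ^ n * Real.exp (freq k)) ≤ weight τ n k := by
  have h := le_weight_of_mem (τ := τ) (right_mem_Icc.2 zero_le_one) n k
  norm_num at h
  exact h

lemma weight_zero_le (τ : ℝ) (k : ℤ × ℤ) :
    weight τ 0 k ≤ ENNReal.ofReal (Real.exp (2 * freq k)) := by
  refine iSup_le fun s => ENNReal.ofReal_le_ofReal ?_
  rw [pow_zero, one_mul, Real.exp_le_exp]
  nlinarith [s.2.1, freq_nonneg k]

lemma weight_add_le {τ : ℝ} (hτ : 0 ≤ τ) (m n : ℕ) (k l : ℤ × ℤ) :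
    weight τ (m + n) (k + l) ≤ weight τ m k * weight τ n l := by
  refine iSup_le fun s => ?_
  refine le_trans ?_ (mul_le_mul' (le_weight_of_mem s.2 m k) (le_weight_of_mem s.2 n l))
  have hs : 0 ≤ τ * s := mul_nonneg hτ s.2.1
  rw [← ENNReal.ofReal_mul (by positivity)]
  refine ENNReal.ofReal_le_ofReal ?_
  rw [mul_mul_mul_comm, ← pow_add, ← Real.exp_add, ← mul_add]
  refine mul_le_mul_of_nonneg_left (Real.exp_le_exp.2 ?_) (by positivity)
  exact mul_le_mul_of_nonneg_left (freq_add_le k l) (by linarith [s.2.2])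

lemma weight_succ_le {τ : ℝ} (hτ : 0 ≤ τ) (n : ℕ) (k : ℤ × ℤ) :
    weight τ (n + 1) k ≤ ENNReal.ofReal τ * weight τ n k := by
  refine iSup_le fun s => ?_
  refine le_trans ?_ (mul_le_mul_right (le_weight_of_mem s.2 n k) _)
  have hs : 0 ≤ τ * s := mul_nonneg hτ s.2.1
  rw [← ENNReal.ofReal_mul hτ]
  refine ENNReal.ofReal_le_ofReal ?_
  rw [pow_succ', mul_assoc]
  exact mul_le_mul_of_nonneg_right (mul_le_of_le_one_right hτ s.2.2) (by positivity)

/-- The loss of one space derivative is compensated by the gain of one time primitive. -/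
lemma freq_mul_weight_succ_le {τ : ℝ} (hτ : 0 ≤ τ) (n : ℕ) (k : ℤ × ℤ) :
    ENNReal.ofReal (freq k) * weight τ (n + 1) k ≤
      ENNReal.ofReal (τ * (n + 1)) * weight τ n k := by
  set a := freq k with ha
  have ha0 : 0 ≤ a := freq_nonneg k
  rw [weight, ENNReal.mul_iSup]
  refine iSup_le fun ⟨s, hs⟩ => ?_
  obtain ⟨s', hs', h⟩ : ∃ s' ∈ Icc (0 : ℝ) 1,
      a * (s ^ (n + 1) * Real.exp ((2 - s) * a)) ≤
        (n + 1) * (s' ^ n * Real.exp ((2 - s') * a)) := by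
    by_cases hsa : a * s ≤ n + 1
    · refine ⟨s, hs, ?_⟩
      rw [pow_succ', mul_assoc, ← mul_assoc]
      have := hs.1
      exact mul_le_mul_of_nonneg_right hsa (by positivity)
    · push Not at hsa
      have hn : (0 : ℝ) < n + 1 := by positivity
      have ha1 : 0 < a := by
        rcases ha0.eq_or_lt with h | h
        · rw [← h, zero_mul] at hsa
          linarith
        · exact h
      have hs0 : (n + 1) / a ≤ s := (div_le_iff₀' ha1).2 hsa.le
      have hpos : 0 < (n + 1) / a := by positivity
      refine ⟨(n + 1) / a, ⟨hpos.le, hs0.trans hs.2⟩, ?_⟩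
      set s₀ := (n + 1) / a with hs₀
      have has : a * s₀ = n + 1 := by
        rw [hs₀]
        field_simp
      have h₁ : s / s₀ ≤ Real.exp (s / s₀ - 1) := by
        simpa using Real.add_one_le_exp (s / s₀ - 1)
      have h₂ : (s / s₀) ^ (n + 1) ≤ Real.exp (a * s - a * s₀) := by
        calc (s / s₀) ^ (n + 1) ≤ Real.exp (s / s₀ - 1) ^ (n + 1) :=
              pow_le_pow_left₀ (div_nonneg hs.1 hpos.le) h₁ _
          _ = Real.exp (a * s - a * s₀) := by
              rw [← Real.exp_nat_mul]
              congr 1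
              push_cast
              rw [← has]
              field_simp
      rw [div_pow, div_le_iff₀ (by positivity)] at h₂
      calc a * (s ^ (n + 1) * Real.exp ((2 - s) * a))
          ≤ a * ((Real.exp (a * s - a * s₀) * s₀ ^ (n + 1)) * Real.exp ((2 - s) * a)) := by
            gcongr
        _ = (a * s₀) * (s₀ ^ n * (Real.exp (a * s - a * s₀) * Real.exp ((2 - s) * a))) := by
            ring
        _ = (n + 1) * (s₀ ^ n * Real.exp ((2 - s₀) * a)) := by
            rw [← Real.exp_add, show a * s - a * s₀ + (2 - s) * a = (2 - s₀) * a by ring, has]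
  refine le_trans ?_ (mul_le_mul_right (le_weight_of_mem hs' n k) _)
  have := hs.1
  have := hs'.1
  rw [← ENNReal.ofReal_mul ha0, ← ENNReal.ofReal_mul (by positivity)]
  refine ENNReal.ofReal_le_ofReal ?_
  calc a * ((τ * s) ^ (n + 1) * Real.exp ((2 - s) * a))
      = τ ^ (n + 1) * (a * (s ^ (n + 1) * Real.exp ((2 - s) * a))) := by
        rw [mul_pow]
        ring
    _ ≤ τ ^ (n + 1) * ((n + 1) * (s' ^ n * Real.exp ((2 - s') * a))) := by gcongr
    _ = τ * (n + 1) * ((τ * s') ^ n * Real.exp ((2 - s') * freq k)) := by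
        rw [mul_pow]
        ring

/-- The Cauchy product formula in `ℝ≥0∞`. -/
lemma tsum_mul_tsum_antidiagonal (α β : ℕ → ℝ≥0∞) :
    (∑' n, α n) * ∑' n, β n =
      ∑' n, ∑ q ∈ Finset.HasAntidiagonal.antidiagonal n, α q.1 * β q.2 := by
  have h : ∀ n, ∑ q ∈ Finset.HasAntidiagonal.antidiagonal n, α q.1 * β q.2 =
      ∑' q : Finset.HasAntidiagonal.antidiagonal n, α q.1.1 * β q.1.2 := fun n =>
    (Finset.tsum_subtype _ fun q : ℕ × ℕ => α q.1 * β q.2).symm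
  simp_rw [h]
  rw [← ENNReal.tsum_sigma' fun x : Σ n : ℕ, Finset.HasAntidiagonal.antidiagonal n =>
      α x.2.1.1 * β x.2.1.2]
  refine Eq.trans ?_
    (Finset.HasAntidiagonal.sigmaAntidiagonalEquivProd.tsum_eq fun q : ℕ × ℕ => α q.1 * β q.2).symm
  rw [ENNReal.tsum_prod (f := fun m n => α m * β n)]
  simp_rw [ENNReal.tsum_mul_left, ENNReal.tsum_mul_right]

namespace TrigPoly

/-- The weighted `ℓ¹` norm of the coefficients. -/
noncomputable def wnorm (W : ℤ × ℤ → ℝ≥0∞) (r : TrigPoly) : ℝ≥0∞ := ∑' k, W k * ‖r.coeff k‖ₑ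

lemma wnorm_zero (W : ℤ × ℤ → ℝ≥0∞) : wnorm W 0 = 0 := by
  simp [wnorm]

lemma wnorm_add_le (W : ℤ × ℤ → ℝ≥0∞) (r s : TrigPoly) :
    wnorm W (r + s) ≤ wnorm W r + wnorm W s := by
  rw [wnorm, wnorm, wnorm, ← ENNReal.tsum_add]
  refine ENNReal.tsum_le_tsum fun k => ?_
  rw [← mul_add]
  exact mul_le_mul_right (enorm_add_le _ _) _

lemma wnorm_neg (W : ℤ × ℤ → ℝ≥0∞) (r : TrigPoly) : wnorm W (-r) = wnorm W r := by
  simp [wnorm]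

lemma wnorm_sum_le {ι : Type*} (W : ℤ × ℤ → ℝ≥0∞) (s : Finset ι) (r : ι → TrigPoly) :
    wnorm W (∑ i ∈ s, r i) ≤ ∑ i ∈ s, wnorm W (r i) :=
  Finset.le_sum_of_subadditive _ (wnorm_zero W).le (wnorm_add_le W) _ _

lemma wnorm_single (W : ℤ × ℤ → ℝ≥0∞) (k : ℤ × ℤ) (c : ℂ) :
    wnorm W (AddMonoidAlgebra.single k c) = W k * ‖c‖ₑ := by
  classical
  rw [wnorm, tsum_eq_single k]
  · simp
  · intro l hl
    simp [hl.symm]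

lemma wnorm_ne_top {W : ℤ × ℤ → ℝ≥0∞} (hW : ∀ k, W k ≠ ⊤) (r : TrigPoly) : wnorm W r ≠ ⊤ := by
  rw [wnorm, tsum_eq_sum (s := r.coeff.support)]
  · exact ENNReal.sum_ne_top.2 fun k _ => ENNReal.mul_ne_top (hW k) enorm_ne_top
  · intro k hk
    simp [Finsupp.notMem_support_iff.1 hk]

lemma wnorm_mono {W W' : ℤ × ℤ → ℝ≥0∞} (h : ∀ k, W k ≤ W' k) (r : TrigPoly) :
    wnorm W r ≤ wnorm W' r :=
  ENNReal.tsum_le_tsum fun k => mul_le_mul_left (h k) _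

lemma wnorm_mul_le {W W₁ W₂ : ℤ × ℤ → ℝ≥0∞} (h : ∀ k l, W (k + l) ≤ W₁ k * W₂ l)
    (r s : TrigPoly) : wnorm W (r * s) ≤ wnorm W₁ r * wnorm W₂ s := by
  rw [AddMonoidAlgebra.mul_def, Finsupp.sum]
  calc wnorm W (∑ k ∈ r.coeff.support, s.coeff.sum fun l d =>
          AddMonoidAlgebra.single (k + l) (r.coeff k * d))
      ≤ ∑ k ∈ r.coeff.support, ∑ l ∈ s.coeff.support,
          (W₁ k * ‖r.coeff k‖ₑ) * (W₂ l * ‖s.coeff l‖ₑ) := by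
        refine (wnorm_sum_le _ _ _).trans (Finset.sum_le_sum fun k _ => ?_)
        refine (wnorm_sum_le _ _ _).trans (Finset.sum_le_sum fun l _ => ?_)
        rw [wnorm_single, enorm_mul, mul_mul_mul_comm]
        exact mul_le_mul_left (h k l) _
    _ = (∑ k ∈ r.coeff.support, W₁ k * ‖r.coeff k‖ₑ) *
          ∑ l ∈ s.coeff.support, W₂ l * ‖s.coeff l‖ₑ := by
        rw [Finset.sum_mul_sum]
    _ ≤ _ := mul_le_mul' (ENNReal.sum_le_tsum _) (ENNReal.sum_le_tsum _)

end TrigPoly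

namespace Series

open PowerSeries

/-- The weighted `ℓ¹` norm of a series in time and space. -/
noncomputable def norm (τ : ℝ) (a : Series) : ℝ≥0∞ :=
  ∑' n, TrigPoly.wnorm (weight τ n) (coeff n a)

lemma norm_add_le (τ : ℝ) (a b : Series) : norm τ (a + b) ≤ norm τ a + norm τ b := by
  rw [norm, norm, norm, ← ENNReal.tsum_add]
  exact ENNReal.tsum_le_tsum fun n => by simpa using TrigPoly.wnorm_add_le _ _ _

lemma norm_neg (τ : ℝ) (a : Series) : norm τ (-a) = norm τ a := by
  simp [norm, TrigPoly.wnorm_neg]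

lemma norm_sub_le (τ : ℝ) (a b : Series) : norm τ (a - b) ≤ norm τ a + norm τ b := by
  rw [sub_eq_add_neg, ← norm_neg τ b]
  exact norm_add_le τ a (-b)

lemma norm_two_mul_le (τ : ℝ) (a : Series) : norm τ (2 * a) ≤ 2 * norm τ a := by
  rw [two_mul, two_mul]
  exact norm_add_le τ a a

lemma norm_mul_le {τ : ℝ} (hτ : 0 ≤ τ) (a b : Series) :
    norm τ (a * b) ≤ norm τ a * norm τ b := by
  rw [norm, norm, norm, tsum_mul_tsum_antidiagonal]
  refine ENNReal.tsum_le_tsum fun n => ?_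
  rw [coeff_mul]
  refine (TrigPoly.wnorm_sum_le _ _ _).trans (Finset.sum_le_sum fun q hq => ?_)
  rw [← Finset.HasAntidiagonal.mem_antidiagonal.1 hq]
  exact TrigPoly.wnorm_mul_le (weight_add_le hτ q.1 q.2) _ _

lemma norm_C_le (τ : ℝ) (r : TrigPoly) :
    norm τ (C r) ≤ TrigPoly.wnorm (fun k => ENNReal.ofReal (Real.exp (2 * freq k))) r := by
  rw [norm, tsum_eq_single 0]
  · rw [coeff_zero_C]
    exact TrigPoly.wnorm_mono (weight_zero_le τ) r
  · intro n hn
    rw [coeff_C, if_neg hn, TrigPoly.wnorm_zero]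

lemma enorm_inv_natCast_add_one (n : ℕ) :
    ENNReal.ofReal ((n : ℝ) + 1) * ‖((n : ℂ) + 1)⁻¹‖ₑ = 1 := by
  have h : ‖((n : ℂ) + 1)⁻¹‖ = ((n : ℝ) + 1)⁻¹ := by
    rw [norm_inv, ← Nat.cast_add_one, Complex.norm_natCast, Nat.cast_add_one]
  rw [← ofReal_norm, h, ← ENNReal.ofReal_mul (by positivity), mul_inv_cancel₀ (by positivity),
    ENNReal.ofReal_one]

lemma norm_prim_le {τ : ℝ} (hτ : 0 ≤ τ) (a : Series) :
    norm τ (prim a) ≤ ENNReal.ofReal τ * norm τ a := by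
  rw [norm, tsum_eq_zero_add' ENNReal.summable, coeff_zero_prim, TrigPoly.wnorm_zero, zero_add,
    norm, ← ENNReal.tsum_mul_left]
  refine ENNReal.tsum_le_tsum fun n => ?_
  rw [TrigPoly.wnorm, TrigPoly.wnorm, ← ENNReal.tsum_mul_left]
  refine ENNReal.tsum_le_tsum fun k => ?_
  rw [coeff_succ_prim, AddMonoidAlgebra.coeff_smul_apply, enorm_smul,
    ← mul_assoc (ENNReal.ofReal τ)]
  refine mul_le_mul' (weight_succ_le hτ n k) (mul_le_of_le_one_left' ?_)
  rw [← enorm_inv_natCast_add_one n]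
  refine le_mul_of_one_le_left' ?_
  rw [← ENNReal.ofReal_one]
  exact ENNReal.ofReal_le_ofReal (by linarith [n.cast_nonneg (α := ℝ)])

lemma norm_prim_space_le {τ : ℝ} (hτ : 0 ≤ τ) {v : ℝ × ℝ} (hv : ‖v‖ ≤ 1) (a : Series) :
    norm τ (prim (space v a)) ≤ ENNReal.ofReal τ * norm τ a := by
  rw [norm, tsum_eq_zero_add' ENNReal.summable, coeff_zero_prim, TrigPoly.wnorm_zero, zero_add,
    norm, ← ENNReal.tsum_mul_left]
  refine ENNReal.tsum_le_tsum fun n => ?_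
  rw [TrigPoly.wnorm, TrigPoly.wnorm, ← ENNReal.tsum_mul_left]
  refine ENNReal.tsum_le_tsum fun k => ?_
  rw [coeff_succ_prim, AddMonoidAlgebra.coeff_smul_apply, coeff_space, TrigPoly.coeff_deriv,
    enorm_smul, enorm_mul]
  have h₁ : ‖phase k v‖ₑ ≤ ENNReal.ofReal (freq k) := by
    rw [← ofReal_norm]
    refine ENNReal.ofReal_le_ofReal ((norm_phase_apply_le k v).trans ?_)
    exact mul_le_of_le_one_right (freq_nonneg k) hv
  calc weight τ (n + 1) k * (‖((n : ℂ) + 1)⁻¹‖ₑ * (‖phase k v‖ₑ * ‖(coeff n a).coeff k‖ₑ))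
      ≤ weight τ (n + 1) k *
          (‖((n : ℂ) + 1)⁻¹‖ₑ * (ENNReal.ofReal (freq k) * ‖(coeff n a).coeff k‖ₑ)) := by gcongr
    _ = (ENNReal.ofReal (freq k) * weight τ (n + 1) k) *
          (‖((n : ℂ) + 1)⁻¹‖ₑ * ‖(coeff n a).coeff k‖ₑ) := by ring
    _ ≤ (ENNReal.ofReal (τ * (n + 1)) * weight τ n k) *
          (‖((n : ℂ) + 1)⁻¹‖ₑ * ‖(coeff n a).coeff k‖ₑ) := by
        exact mul_le_mul_left (freq_mul_weight_succ_le hτ n k) _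
    _ = (ENNReal.ofReal (n + 1) * ‖((n : ℂ) + 1)⁻¹‖ₑ) *
          (ENNReal.ofReal τ * (weight τ n k * ‖(coeff n a).coeff k‖ₑ)) := by
        rw [ENNReal.ofReal_mul hτ]
        ring
    _ = _ := by rw [enorm_inv_natCast_add_one, one_mul]

/-- The norm is lower semicontinuous for the `X`-adic topology. -/
lemma norm_le_of_forall_congr {τ : ℝ} {a : Series} {B : ℝ≥0∞}
    (h : ∀ n : ℕ, ∃ b, X ^ n ∣ a - b ∧ norm τ b ≤ B) : norm τ a ≤ B := by
  rw [norm, ENNReal.tsum_eq_iSup_nat]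
  refine iSup_le fun n => ?_
  obtain ⟨b, hab, hb⟩ := h n
  refine le_trans ?_ ((ENNReal.sum_le_tsum (Finset.range n)).trans hb)
  refine Finset.sum_le_sum fun m hm => le_of_eq ?_
  have h' := X_pow_dvd_iff.1 hab m (Finset.mem_range.1 hm)
  rw [map_sub, sub_eq_zero] at h'
  rw [h']

end Series

namespace Series

open PowerSeries

/-- The right hand side of the flow, for `U = (f, g, Λ, u)`. -/
noncomputable def velocity (U : Fin 4 → Series) : Fin 4 → Series :=
  ![2 * space (0, 1) (U 3),
    -(2 * space (1, 0) (U 3)),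
    space (1, 0) (U 1 * U 2) + space (0, 1) (U 0 * U 2),
    2 * space (0, 1) (U 0 * U 2) - 2 * space (1, 0) (U 1 * U 2) +
      U 0 * space (0, 1) (U 3) + U 1 * space (1, 0) (U 3)]

/-- The integral form of the flow with initial data `U₀`. -/
noncomputable def step (U₀ : Fin 4 → TrigPoly) (U : Fin 4 → Series) (i : Fin 4) : Series :=
  C (U₀ i) + prim (velocity U i)

lemma X_pow_dvd_mul_sub_mul {n : ℕ} {a b a' b' : Series} (ha : X ^ n ∣ a - a')
    (hb : X ^ n ∣ b - b') : X ^ n ∣ a * b - a' * b' := by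
  have h := (hb.mul_left a).add (ha.mul_left b')
  rwa [show a * (b - b') + b' * (a - a') = a * b - a' * b' by ring] at h

lemma X_pow_dvd_velocity_sub {n : ℕ} {U V : Fin 4 → Series} (h : ∀ i, X ^ n ∣ U i - V i)
    (i : Fin 4) : X ^ n ∣ velocity U i - velocity V i := by
  have hs : ∀ (v : ℝ × ℝ) {a b : Series}, X ^ n ∣ a - b → X ^ n ∣ space v a - space v b :=
    fun v a b hab => by
      rw [← map_sub]
      exact X_pow_dvd_space v hab
  have h2 : ∀ {a b : Series}, X ^ n ∣ a - b → X ^ n ∣ 2 * a - 2 * b := fun hab => by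
    rw [← mul_sub]
    exact hab.mul_left 2
  have ha : ∀ {a b c d : Series}, X ^ n ∣ a - b → X ^ n ∣ c - d →
      X ^ n ∣ (a + c) - (b + d) := fun hab hcd => by
    rw [add_sub_add_comm]
    exact hab.add hcd
  have hfl := X_pow_dvd_mul_sub_mul (h 0) (h 2)
  have hgl := X_pow_dvd_mul_sub_mul (h 1) (h 2)
  fin_cases i
  · exact h2 (hs _ (h 3))
  · have h' := (h2 (hs (1, 0) (h 3))).neg_right
    rw [neg_sub'] at h'
    exact h'
  · exact ha (hs _ hgl) (hs _ hfl)
  · refine ha (ha ?_ (X_pow_dvd_mul_sub_mul (h 0) (hs _ (h 3))))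
      (X_pow_dvd_mul_sub_mul (h 1) (hs _ (h 3)))
    rw [sub_sub_sub_comm]
    exact (h2 (hs _ hfl)).sub (h2 (hs _ hgl))

lemma X_pow_succ_dvd_step_sub (U₀ : Fin 4 → TrigPoly) (n : ℕ) (U V : Fin 4 → Series)
    (h : ∀ i, X ^ n ∣ U i - V i) (i : Fin 4) : X ^ (n + 1) ∣ step U₀ U i - step U₀ V i := by
  rw [step, step, add_sub_add_left_eq_sub, ← map_sub]
  exact X_pow_succ_dvd_prim (X_pow_dvd_velocity_sub h i)

/-- A bound on the values and the first space derivatives of a state. -/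
def BoundedBy (τ : ℝ) (B : ℝ≥0∞) (U : Fin 4 → Series) : Prop :=
  ∀ i, norm τ (U i) ≤ B ∧ norm τ (space (1, 0) (U i)) ≤ B ∧ norm τ (space (0, 1) (U i)) ≤ B

lemma norm_space_mul_le {τ : ℝ} (hτ : 0 ≤ τ) {v : ℝ × ℝ} {B : ℝ≥0∞} {a b : Series}
    (ha : norm τ a ≤ B) (hb : norm τ b ≤ B) (ha' : norm τ (space v a) ≤ B)
    (hb' : norm τ (space v b) ≤ B) : norm τ (space v (a * b)) ≤ 2 * B ^ 2 := by
  rw [space_mul]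
  calc norm τ (a * space v b + space v a * b)
      ≤ norm τ a * norm τ (space v b) + norm τ (space v a) * norm τ b :=
        (norm_add_le _ _ _).trans (add_le_add (norm_mul_le hτ _ _) (norm_mul_le hτ _ _))
    _ ≤ B * B + B * B := by gcongr
    _ = 2 * B ^ 2 := by ring

lemma BoundedBy.norm_velocity_le {τ : ℝ} (hτ : 0 ≤ τ) {B : ℝ≥0∞} (hB : 1 ≤ B)
    {U : Fin 4 → Series} (h : BoundedBy τ B U) (i : Fin 4) :
    norm τ (velocity U i) ≤ 10 * B ^ 2 := by
  have hBB : B ≤ B ^ 2 := by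
    rw [sq]
    exact le_mul_of_one_le_left' hB
  have h2 : ∀ {a : Series} {b : ℝ≥0∞}, norm τ a ≤ b → norm τ (2 * a) ≤ 2 * b := fun ha =>
    (norm_two_mul_le τ _).trans (by gcongr)
  have hfx := norm_space_mul_le hτ (h 0).1 (h 2).1 (h 0).2.2 (h 2).2.2
  have hgx := norm_space_mul_le hτ (h 1).1 (h 2).1 (h 1).2.1 (h 2).2.1
  have hm : ∀ {a b : Series}, norm τ a ≤ B → norm τ b ≤ B → norm τ (a * b) ≤ B ^ 2 :=
    fun ha hb => (norm_mul_le hτ _ _).trans (by rw [sq]; exact mul_le_mul' ha hb)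
  have h10 : ∀ {c : ℝ≥0∞}, c ≤ 10 → c * B ^ 2 ≤ 10 * B ^ 2 := fun hc => mul_le_mul_left hc _
  fin_cases i
  · exact (h2 ((h 3).2.2.trans hBB)).trans (h10 (by norm_num))
  · exact (norm_neg τ _).le.trans ((h2 ((h 3).2.1.trans hBB)).trans (h10 (by norm_num)))
  · refine (norm_add_le _ _ _).trans ((add_le_add hgx hfx).trans ?_)
    rw [← add_mul]
    exact h10 (by norm_num)
  · calc norm τ (2 * space (0, 1) (U 0 * U 2) - 2 * space (1, 0) (U 1 * U 2) +
          U 0 * space (0, 1) (U 3) + U 1 * space (1, 0) (U 3))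
        ≤ 2 * (2 * B ^ 2) + 2 * (2 * B ^ 2) + B ^ 2 + B ^ 2 := by
          refine (norm_add_le _ _ _).trans (add_le_add ((norm_add_le _ _ _).trans
            (add_le_add ((norm_sub_le _ _ _).trans (add_le_add (h2 hfx) (h2 hgx))) ?_)) ?_)
          · exact hm (h 0).1 (h 3).2.2
          · exact hm (h 1).1 (h 3).2.1
      _ = 10 * B ^ 2 := by ring

lemma BoundedBy.step {τ : ℝ} (hτ : 0 ≤ τ) {A : ℝ≥0∞} {U₀ : Fin 4 → TrigPoly}
    (h₀ : BoundedBy τ A fun i => C (U₀ i)) (hA : ENNReal.ofReal τ * (10 * (A + 1) ^ 2) ≤ 1)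
    {U : Fin 4 → Series} (h : BoundedBy τ (A + 1) U) : BoundedBy τ (A + 1) (step U₀ U) := by
  intro i
  have hv := h.norm_velocity_le hτ le_add_self i
  have hp : ENNReal.ofReal τ * norm τ (velocity U i) ≤ 1 :=
    (mul_le_mul_right hv _).trans hA
  have hd : ∀ v : ℝ × ℝ, ‖v‖ ≤ 1 → norm τ (space v (C (U₀ i))) ≤ A →
      norm τ (space v (Series.step U₀ U i)) ≤ A + 1 := fun v hv hv₀ => by
    rw [Series.step, map_add, space_prim]
    exact (norm_add_le _ _ _).trans
      (add_le_add hv₀ ((norm_prim_space_le hτ hv _).trans hp))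
  refine ⟨?_, hd _ (by simp) (h₀ i).2.1, hd _ (by simp) (h₀ i).2.2⟩
  exact (norm_add_le _ _ _).trans (add_le_add (h₀ i).1 ((norm_prim_le hτ _).trans hp))

lemma BoundedBy.of_forall_congr {τ : ℝ} {B : ℝ≥0∞} {U : Fin 4 → Series}
    {V : ℕ → Fin 4 → Series} (hV : ∀ n, BoundedBy τ B (V n))
    (h : ∀ (n : ℕ) (i : Fin 4), X ^ n ∣ U i - V n i) : BoundedBy τ B U := by
  have hd : ∀ (v : ℝ × ℝ) (n : ℕ) (i : Fin 4), X ^ n ∣ space v (U i) - space v (V n i) :=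
    fun v n i => by
      rw [← map_sub]
      exact X_pow_dvd_space v (h n i)
  exact fun i => ⟨norm_le_of_forall_congr fun n => ⟨_, h n i, (hV n i).1⟩,
    norm_le_of_forall_congr fun n => ⟨_, hd _ n i, (hV n i).2.1⟩,
    norm_le_of_forall_congr fun n => ⟨_, hd _ n i, (hV n i).2.2⟩⟩

/-- A series is real if all its coefficients are. -/
def IsReal (a : Series) : Prop := ∀ n, (coeff n a).IsReal

lemma IsReal.add {a b : Series} (ha : IsReal a) (hb : IsReal b) : IsReal (a + b) := fun n => by
  rw [map_add]
  exact (ha n).add (hb n)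

lemma IsReal.neg {a : Series} (ha : IsReal a) : IsReal (-a) := fun n => by
  rw [map_neg]
  exact (ha n).neg

lemma IsReal.sub {a b : Series} (ha : IsReal a) (hb : IsReal b) : IsReal (a - b) := by
  rw [sub_eq_add_neg]
  exact ha.add hb.neg

lemma IsReal.two_mul {a : Series} (ha : IsReal a) : IsReal (2 * a) := by
  rw [_root_.two_mul]
  exact ha.add ha

lemma IsReal.mul {a b : Series} (ha : IsReal a) (hb : IsReal b) : IsReal (a * b) := fun n => by
  rw [coeff_mul]
  exact TrigPoly.IsReal.sum fun q _ => (ha q.1).mul (hb q.2)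

lemma IsReal.space {a : Series} (ha : IsReal a) (v : ℝ × ℝ) : IsReal (space v a) := fun n => by
  rw [coeff_space]
  exact (ha n).deriv v

lemma IsReal.prim {a : Series} (ha : IsReal a) : IsReal (prim a) := fun n => by
  have h := (ha (n - 1)).smul (n : ℝ)⁻¹
  rw [Complex.ofReal_inv, Complex.ofReal_natCast] at h
  rwa [coeff_prim]

lemma IsReal.C {r : TrigPoly} (hr : r.IsReal) : IsReal (C r) := fun n => by
  rw [coeff_C]
  split_ifs
  · exact hr
  · exact TrigPoly.isReal_zero

lemma isReal_velocity {U : Fin 4 → Series} (h : ∀ i, IsReal (U i)) (i : Fin 4) :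
    IsReal (velocity U i) := by
  fin_cases i
  · exact ((h 3).space _).two_mul
  · exact ((h 3).space _).two_mul.neg
  · exact (((h 1).mul (h 2)).space _).add (((h 0).mul (h 2)).space _)
  · exact (((((h 0).mul (h 2)).space _).two_mul.sub (((h 1).mul (h 2)).space _).two_mul).add
      ((h 0).mul ((h 3).space _))).add ((h 1).mul ((h 3).space _))

lemma isReal_of_forall_congr {a : Series} (h : ∀ n : ℕ, ∃ b, X ^ n ∣ a - b ∧ IsReal b) :
    IsReal a := fun n => by
  obtain ⟨b, hab, hb⟩ := h (n + 1)
  have h' := X_pow_dvd_iff.1 hab n n.lt_succ_self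
  rw [map_sub, sub_eq_zero] at h'
  rw [h']
  exact hb n

/-- The flow has a formal solution for all initial data. -/
lemma exists_step_eq (U₀ : Fin 4 → TrigPoly) (hU₀ : ∀ i, (U₀ i).IsReal) :
    ∃ U : Fin 4 → Series, step U₀ U = U ∧ (∀ i, IsReal (U i)) ∧
      ∃ B : ℝ≥0∞, B ≠ ⊤ ∧ ∀ τ : ℝ, 0 ≤ τ → ENNReal.ofReal τ * (10 * B ^ 2) ≤ 1 →
        ∀ i, norm τ (U i) ≤ B ∧ norm τ (space (1, 0) (U i)) ≤ B ∧
          norm τ (space (0, 1) (U i)) ≤ B ∧ norm τ (velocity U i) ≤ 10 * B ^ 2 := by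
  obtain ⟨U, hU, hlim⟩ := exists_fixedPoint (X_pow_succ_dvd_step_sub U₀) 0
  refine ⟨U, hU, fun i => isReal_of_forall_congr fun n => ⟨_, hlim n i, ?_⟩, ?_⟩
  · induction n generalizing i with
    | zero => exact fun n => TrigPoly.isReal_zero
    | succ n ih =>
      rw [Function.iterate_succ_apply']
      exact (IsReal.C (hU₀ i)).add (isReal_velocity ih i).prim
  let w : TrigPoly → ℝ≥0∞ := TrigPoly.wnorm fun k => ENNReal.ofReal (Real.exp (2 * freq k))
  have hw : ∀ r, w r ≠ ⊤ := TrigPoly.wnorm_ne_top fun k => ENNReal.ofReal_ne_top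
  let A : ℝ≥0∞ := ∑ i, (w (U₀ i) + w (TrigPoly.deriv (1, 0) (U₀ i)) +
    w (TrigPoly.deriv (0, 1) (U₀ i)))
  have hA : A ≠ ⊤ := ENNReal.sum_ne_top.2 fun i _ => by simp [hw]
  have hAi : ∀ i, w (U₀ i) + w (TrigPoly.deriv (1, 0) (U₀ i)) +
      w (TrigPoly.deriv (0, 1) (U₀ i)) ≤ A := fun i =>
    Finset.single_le_sum (f := fun i => w (U₀ i) + w (TrigPoly.deriv (1, 0) (U₀ i)) +
      w (TrigPoly.deriv (0, 1) (U₀ i))) (fun _ _ => zero_le) (Finset.mem_univ i)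
  refine ⟨A + 1, by simp [hA], fun τ hτ hτA => ?_⟩
  have h₀ : BoundedBy τ A fun i => C (U₀ i) := fun i => by
    simp only [space_C]
    refine ⟨(norm_C_le τ _).trans (le_trans ?_ (hAi i)),
      (norm_C_le τ _).trans (le_trans ?_ (hAi i)),
      (norm_C_le τ _).trans (le_trans ?_ (hAi i))⟩
    · rw [add_assoc]
      exact le_self_add
    · exact le_add_self.trans le_self_add
    · exact le_add_self
  have hB : BoundedBy τ (A + 1) U := by
    refine BoundedBy.of_forall_congr (fun n => ?_) hlim
    induction n with
    | zero => exact fun i => by simp [norm, TrigPoly.wnorm_zero]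
    | succ n ih =>
      rw [Function.iterate_succ_apply']
      exact BoundedBy.step hτ h₀ hτA ih
  exact fun i => ⟨(hB i).1, (hB i).2.1, (hB i).2.2, hB.norm_velocity_le hτ le_add_self i⟩

/-- The flow preserves the equations of the magnetic geodesic system. -/
lemma step_eq_equations {r₁ r₂ : TrigPoly} (h₁ : TrigPoly.deriv (0, 1) r₁ = 0)
    (h₂ : TrigPoly.deriv (1, 0) r₂ = 0) {U : Fin 4 → Series}
    (hU : step ![0, 0, r₁ + r₂, 2 * r₂ - 2 * r₁] U = U) :
    space (1, 0) (U 0) + space (0, 1) (U 1) = 0 ∧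
    space (1, 0) (U 0 * U 2) - space (0, 1) (U 1 * U 2) = 0 ∧
    2 * space (1, 0) (U 3) + 4 * space (1, 0) (U 2) -
      U 1 * (space (0, 1) (U 0) - space (1, 0) (U 1)) = 0 ∧
    -(2 * space (0, 1) (U 3)) + 4 * space (0, 1) (U 2) +
      U 0 * (space (0, 1) (U 0) - space (1, 0) (U 1)) = 0 := by
  have hi : ∀ i, C (![0, 0, r₁ + r₂, 2 * r₂ - 2 * r₁] i) + prim (velocity U i) = U i :=
    fun i => congrFun hU i
  have hf : prim (2 * space (0, 1) (U 3)) = U 0 := by simpa [velocity] using hi 0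
  have hg : prim (-(2 * space (1, 0) (U 3))) = U 1 := by simpa [velocity] using hi 1
  have hl : C (r₁ + r₂) + prim (space (1, 0) (U 1 * U 2) + space (0, 1) (U 0 * U 2)) = U 2 :=
    hi 2
  have hu : C (2 * r₂ - 2 * r₁) + prim (2 * space (0, 1) (U 0 * U 2) -
      2 * space (1, 0) (U 1 * U 2) + U 0 * space (0, 1) (U 3) + U 1 * space (1, 0) (U 3)) = U 3 :=
    hi 3
  have time_C : ∀ r : TrigPoly, time (C r) = 0 := fun r => by
    ext1 n
    rw [coeff_time, coeff_C, if_neg n.succ_ne_zero]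
    simp
  have ht₀ := congrArg time hf
  have ht₁ := congrArg time hg
  have ht₂ := congrArg time hl
  have ht₃ := congrArg time hu
  simp only [map_add time, time_C, zero_add, time_prim] at ht₀ ht₁ ht₂ ht₃
  have hE₁ : space (1, 0) (U 0) + space (0, 1) (U 1) = 0 := by
    rw [← hf, ← hg, space_prim, space_prim, ← map_add, map_neg, space_two_mul, space_two_mul,
      space_comm (0, 1) (1, 0), add_neg_cancel, map_zero]
  obtain ⟨e₂, e₃, e₄⟩ := defect_evolution time_mul (space_mul (1, 0)) (space_mul (0, 1))
    (time_space (1, 0)) (time_space (0, 1)) (space_comm (0, 1) (1, 0)) ht₀.symm ht₁.symm ht₂.symm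
    ht₃.symm hE₁ rfl rfl rfl
  have c₀ : coeff 0 (U 0) = 0 := by rw [← hf, coeff_zero_prim]
  have c₁ : coeff 0 (U 1) = 0 := by rw [← hg, coeff_zero_prim]
  have c₂ : coeff 0 (U 2) = r₁ + r₂ := by
    rw [← hl, map_add (coeff 0), coeff_zero_C, coeff_zero_prim, add_zero]
  have c₃ : coeff 0 (U 3) = 2 * r₂ - 2 * r₁ := by
    rw [← hu, map_add (coeff 0), coeff_zero_C, coeff_zero_prim, add_zero]
  have c_mul : ∀ a b : Series, coeff 0 (a * b) = coeff 0 a * coeff 0 b := fun a b => by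
    simp [coeff_zero_eq_constantCoeff]
  have h2 : ∀ v r, TrigPoly.deriv v (2 * r) = 2 * TrigPoly.deriv v r := fun v r => by
    rw [two_mul, map_add, two_mul]
  have hC : ∀ (m : ℕ) [m.AtLeastTwo], coeff 0 (OfNat.ofNat m : Series) = OfNat.ofNat m :=
    fun m _ => by
      rw [coeff_zero_eq_constantCoeff]
      exact map_ofNat constantCoeff m
  refine ⟨hE₁, eq_zero_of_linear_evolution e₂ e₃ e₄ ?_ ?_ ?_⟩
  · simp only [map_sub, coeff_space, c_mul, c₀, c₁, zero_mul, map_zero, sub_zero]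
  · simp only [map_sub, map_add, coeff_space, c_mul, c₁, c₂, c₃, zero_mul, sub_zero, h2, h₂, hC]
    ring
  · simp only [map_sub, map_add, map_neg, coeff_space, c_mul, c₀, c₂, c₃, zero_mul, h2, h₁, hC]
    ring

end Series

section ExponentialSums

variable {ι E : Type*} [NormedAddCommGroup E] [NormedSpace ℝ E]

/-- The power series at the origin of `x ↦ ∑' i, d i * exp (L i x)`. -/
noncomputable def expSumSeries (d : ι → ℂ) (L : ι → E →L[ℝ] ℂ) : FormalMultilinearSeries ℝ E ℂ :=
  fun m => ∑' i, (d i / m.factorial) •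
    (ContinuousMultilinearMap.mkPiAlgebraFin ℝ m ℂ).compContinuousLinearMap fun _ => L i

lemma norm_expSumSeries_term_le (d : ℂ) (L : E →L[ℝ] ℂ) (m : ℕ) :
    ‖(d / m.factorial) •
      (ContinuousMultilinearMap.mkPiAlgebraFin ℝ m ℂ).compContinuousLinearMap fun _ => L‖ ≤
      ‖d‖ * (‖L‖ ^ m / m.factorial) := by
  rw [norm_smul, norm_div, Complex.norm_natCast, div_mul_eq_mul_div, mul_div_assoc]
  gcongr
  refine (ContinuousMultilinearMap.norm_compContinuousLinearMap_le _ _).trans ?_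
  simp

lemma pow_norm_div_factorial_le {x : ℝ} (hx : 0 ≤ x) (m : ℕ) :
    x ^ m / m.factorial ≤ Real.exp x := by
  have h := Real.sum_le_exp_of_nonneg hx (m + 1)
  refine le_trans ?_ h
  exact Finset.single_le_sum (f := fun i : ℕ => x ^ i / (i.factorial : ℝ))
    (fun i _ => by positivity) (Finset.self_mem_range_succ m)

variable {d : ι → ℂ} {L : ι → E →L[ℝ] ℂ}

lemma summable_expSumSeries (h : Summable fun i => ‖d i‖ * Real.exp ‖L i‖) (m : ℕ) :
    Summable fun i => (d i / m.factorial) •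
      (ContinuousMultilinearMap.mkPiAlgebraFin ℝ m ℂ).compContinuousLinearMap fun _ => L i := by
  refine Summable.of_norm_bounded h fun i => (norm_expSumSeries_term_le _ _ _).trans ?_
  gcongr
  exact pow_norm_div_factorial_le (norm_nonneg _) m

lemma expSumSeries_apply (h : Summable fun i => ‖d i‖ * Real.exp ‖L i‖) (m : ℕ)
    (x : Fin m → E) :
    HasSum (fun i => d i / m.factorial * (List.ofFn fun j => L i (x j)).prod)
      (expSumSeries d L m x) := by
  have h' := (summable_expSumSeries h m).hasSum.mapL
    (ContinuousMultilinearMap.apply ℝ (fun _ : Fin m => E) ℂ x)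
  exact h'

lemma hasFPowerSeriesOnBall_expSum (h : Summable fun i => ‖d i‖ * Real.exp ‖L i‖) {F : E → ℂ}
    {x₀ : E} (hF : ∀ x, F (x₀ + x) = ∑' i, d i * Complex.exp (L i x)) :
    HasFPowerSeriesOnBall F (expSumSeries d L) x₀ 1 where
  r_le := by
    refine FormalMultilinearSeries.le_radius_of_bound _ (∑' i, ‖d i‖ * Real.exp ‖L i‖) fun m => ?_
    rw [NNReal.coe_one, one_pow, mul_one]
    refine tsum_of_norm_bounded h.hasSum fun i => (norm_expSumSeries_term_le _ _ _).trans ?_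
    gcongr
    exact pow_norm_div_factorial_le (norm_nonneg _) m
  r_pos := one_pos
  hasSum := by
    intro x hx
    have hx1 : ‖x‖ < 1 := by
      rw [Metric.mem_eball, edist_zero_right, ← ofReal_norm, ENNReal.ofReal_lt_one] at hx
      exact hx
    let T : ι × ℕ → ℂ := fun q => d q.1 / q.2.factorial * L q.1 x ^ q.2
    have hexp : ∀ i, HasSum (fun m : ℕ => ‖d i‖ * (‖L i‖ ^ m / m.factorial))
        (‖d i‖ * Real.exp ‖L i‖) := fun i => by
      rw [Real.exp_eq_exp_ℝ]
      exact (NormedSpace.expSeries_div_hasSum_exp ‖L i‖).mul_left _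
    have hT : Summable T := by
      refine Summable.of_norm_bounded (g := fun q : ι × ℕ =>
        ‖d q.1‖ * (‖L q.1‖ ^ q.2 / q.2.factorial)) ?_ fun q => ?_
      · refine (summable_prod_of_nonneg fun q => by positivity).2 ⟨fun i => (hexp i).summable, ?_⟩
        exact h.congr fun i => (hexp i).tsum_eq.symm
      · have : ‖L q.1 x‖ ≤ ‖L q.1‖ :=
          ((L q.1).le_opNorm x).trans (mul_le_of_le_one_right (norm_nonneg _) hx1.le)
        rw [norm_mul, norm_div, Complex.norm_natCast, norm_pow, div_mul_eq_mul_div, mul_div_assoc]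
        gcongr
    have h₁ : ∀ i, HasSum (fun m => T (i, m)) (d i * Complex.exp (L i x)) := fun i => by
      rw [Complex.exp_eq_exp_ℂ]
      refine ((NormedSpace.expSeries_div_hasSum_exp (L i x)).mul_left (d i)).congr_fun ?_
      intro m
      simp only [T]
      ring
    have h₂ : HasSum T (F (x₀ + x)) := by
      rw [hF, (hT.hasSum.prod_fiberwise h₁).tsum_eq]
      exact hT.hasSum
    refine ((Equiv.prodComm ℕ ι).hasSum_iff.2 h₂).prod_fiberwise fun m => ?_
    refine (expSumSeries_apply h m fun _ => x).congr_fun fun i => ?_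
    simp [T]

lemma hasFDerivAt_expSum (h : Summable fun i => ‖d i‖ * Real.exp ‖L i‖) {F : E → ℂ}
    {x₀ : E} (hF : ∀ x, F (x₀ + x) = ∑' i, d i * Complex.exp (L i x)) :
    ∃ F' : E →L[ℝ] ℂ, HasFDerivAt F F' x₀ ∧ ∀ v, F' v = ∑' i, d i * L i v := by
  refine ⟨_, (hasFPowerSeriesOnBall_expSum h hF).hasFPowerSeriesAt.hasFDerivAt, fun v => ?_⟩
  rw [continuousMultilinearCurryFin1_apply, ← (expSumSeries_apply h 1 _).tsum_eq]
  simp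

end ExponentialSums

namespace Series

open PowerSeries

open scoped NNReal

/-- The value of a series at time `τ` and at a point of the plane. -/
noncomputable def value (τ : ℝ) (p : ℝ × ℝ) (a : Series) : ℂ :=
  ∑' q : ℕ × (ℤ × ℤ), (τ : ℂ) ^ q.1 * (coeff q.1 a).coeff q.2 * Complex.exp (phase q.2 p)

lemma tsum_enorm_term_le {τ : ℝ} (hτ : 0 ≤ τ) (a : Series) :
    ∑' q : ℕ × (ℤ × ℤ), ENNReal.ofReal
      (‖(τ : ℂ) ^ q.1 * (coeff q.1 a).coeff q.2‖ * Real.exp (freq q.2)) ≤ norm τ a := by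
  rw [ENNReal.tsum_prod (f := fun n k => ENNReal.ofReal
      (‖(τ : ℂ) ^ n * (coeff n a).coeff k‖ * Real.exp (freq k)))]
  refine ENNReal.tsum_le_tsum fun n => ENNReal.tsum_le_tsum fun k => ?_
  refine le_trans (le_of_eq ?_) (mul_le_mul_left (le_weight τ n k) _)
  rw [← ofReal_norm, ← ENNReal.ofReal_mul (by positivity), norm_mul, norm_pow, Complex.norm_real,
    Real.norm_of_nonneg hτ]
  ring_nf

lemma summable_term {τ : ℝ} (hτ : 0 ≤ τ) {a : Series} (ha : norm τ a ≠ ⊤) :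
    Summable fun q : ℕ × (ℤ × ℤ) =>
      ‖(τ : ℂ) ^ q.1 * (coeff q.1 a).coeff q.2‖ * Real.exp (freq q.2) := by
  refine (ENNReal.summable_toReal (ne_top_of_le_ne_top ha (tsum_enorm_term_le hτ a))).congr
    fun q => ?_
  rw [ENNReal.toReal_ofReal (by positivity)]

lemma norm_term_le (τ : ℝ) (p : ℝ × ℝ) (a : Series) (q : ℕ × (ℤ × ℤ)) :
    ‖(τ : ℂ) ^ q.1 * (coeff q.1 a).coeff q.2 * Complex.exp (phase q.2 p)‖ ≤
      ‖(τ : ℂ) ^ q.1 * (coeff q.1 a).coeff q.2‖ * Real.exp (freq q.2) := by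
  rw [norm_mul, norm_exp_phase]
  exact mul_le_mul_of_nonneg_left (Real.one_le_exp (freq_nonneg _)) (norm_nonneg _)

lemma summable_value {τ : ℝ} (hτ : 0 ≤ τ) (p : ℝ × ℝ) {a : Series} (ha : norm τ a ≠ ⊤) :
    Summable fun q : ℕ × (ℤ × ℤ) =>
      (τ : ℂ) ^ q.1 * (coeff q.1 a).coeff q.2 * Complex.exp (phase q.2 p) :=
  Summable.of_norm_bounded (summable_term hτ ha) (norm_term_le τ p a)

lemma norm_value_le {τ : ℝ} (hτ : 0 ≤ τ) (p : ℝ × ℝ) (a : Series) :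
    ENNReal.ofReal ‖value τ p a‖ ≤ norm τ a := by
  rw [ofReal_norm]
  refine enorm_tsum_le_tsum_enorm.trans (le_trans ?_ (tsum_enorm_term_le hτ a))
  refine ENNReal.tsum_le_tsum fun q => ?_
  rw [← ofReal_norm]
  exact ENNReal.ofReal_le_ofReal (norm_term_le τ p a q)

lemma hasSum_value {τ : ℝ} (hτ : 0 ≤ τ) (p : ℝ × ℝ) {a : Series} (ha : norm τ a ≠ ⊤) :
    HasSum (fun n => (τ : ℂ) ^ n * TrigPoly.eval p (coeff n a)) (value τ p a) := by
  have hs := summable_value hτ p ha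
  refine hs.hasSum.prod_fiberwise fun n => ?_
  rw [TrigPoly.eval_eq_tsum, ← tsum_mul_left]
  simp_rw [← mul_assoc]
  exact (hs.prod_factor n).hasSum

lemma summable_norm_eval {τ : ℝ} (hτ : 0 ≤ τ) (p : ℝ × ℝ) {a : Series} (ha : norm τ a ≠ ⊤) :
    Summable fun n => ‖(τ : ℂ) ^ n * TrigPoly.eval p (coeff n a)‖ := by
  have hs := (summable_value hτ p ha).norm
  refine Summable.of_nonneg_of_le (fun n => norm_nonneg _) (fun n => ?_) hs.prod
  rw [TrigPoly.eval_eq_tsum, ← tsum_mul_left]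
  simp_rw [← mul_assoc]
  exact norm_tsum_le_tsum_norm (hs.prod_factor n)

lemma value_add {τ : ℝ} (hτ : 0 ≤ τ) (p : ℝ × ℝ) {a b : Series} (ha : norm τ a ≠ ⊤)
    (hb : norm τ b ≠ ⊤) : value τ p (a + b) = value τ p a + value τ p b := by
  have hab : norm τ (a + b) ≠ ⊤ := ne_top_of_le_ne_top (by simp [ha, hb]) (norm_add_le τ a b)
  refine (hasSum_value hτ p hab).unique
    (((hasSum_value hτ p ha).add (hasSum_value hτ p hb)).congr_fun
    fun n => ?_)
  rw [map_add, map_add, mul_add]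

lemma value_mul {τ : ℝ} (hτ : 0 ≤ τ) (p : ℝ × ℝ) {a b : Series} (ha : norm τ a ≠ ⊤)
    (hb : norm τ b ≠ ⊤) : value τ p (a * b) = value τ p a * value τ p b := by
  have hab : norm τ (a * b) ≠ ⊤ :=
    ne_top_of_le_ne_top (ENNReal.mul_ne_top ha hb) (norm_mul_le hτ a b)
  rw [← (hasSum_value hτ p ha).tsum_eq, ← (hasSum_value hτ p hb).tsum_eq,
    tsum_mul_tsum_eq_tsum_sum_antidiagonal_of_summable_norm (summable_norm_eval hτ p ha)
      (summable_norm_eval hτ p hb), ← (hasSum_value hτ p hab).tsum_eq]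
  refine tsum_congr fun n => ?_
  rw [coeff_mul, map_sum, Finset.mul_sum]
  refine Finset.sum_congr rfl fun q hq => ?_
  rw [← Finset.HasAntidiagonal.mem_antidiagonal.1 hq, map_mul, pow_add]
  ring

lemma value_C (τ : ℝ) (p : ℝ × ℝ) (r : TrigPoly) : value τ p (C r) = TrigPoly.eval p r := by
  rw [TrigPoly.eval_eq_tsum, value, ← (Prod.mk_right_injective (0 : ℕ)).tsum_eq]
  · simp
  · intro q hq
    by_contra h
    refine hq ?_
    have h0 : q.1 ≠ 0 := fun h0 => h ⟨q.2, by rw [← h0]⟩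
    simp [coeff_C, h0]

lemma value_im {τ : ℝ} (hτ : 0 ≤ τ) (p : ℝ × ℝ) {a : Series} (ha : norm τ a ≠ ⊤)
    (hr : IsReal a) : (value τ p a).im = 0 := by
  refine ((hasSum_value hτ p ha).mapL Complex.imCLM).unique (hasSum_zero.congr_fun fun n => ?_)
  rw [Complex.imCLM_apply, ← Complex.ofReal_pow, Complex.im_ofReal_mul, hr n p, mul_zero]

lemma value_periodic (τ x y : ℝ) (a : Series) :
    value τ (x + 1, y) a = value τ (x, y) a ∧ value τ (x, y + 1) a = value τ (x, y) a := by
  have h : ∀ k : ℤ × ℤ, Complex.exp (phase k (x + 1, y)) = Complex.exp (phase k (x, y)) ∧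
      Complex.exp (phase k (x, y + 1)) = Complex.exp (phase k (x, y)) := fun k => by
    simp only [phase_apply]
    refine ⟨Complex.exp_eq_exp_iff_exists_int.2 ⟨k.1, ?_⟩,
      Complex.exp_eq_exp_iff_exists_int.2 ⟨k.2, ?_⟩⟩ <;>
    · push_cast
      ring
  exact ⟨tsum_congr fun q => by rw [(h q.2).1], tsum_congr fun q => by rw [(h q.2).2]⟩

lemma analyticAt_value {τ : ℝ} (hτ : 0 ≤ τ) {a : Series} (ha : norm τ a ≠ ⊤) (p : ℝ × ℝ) :
    AnalyticAt ℝ (fun p => value τ p a) p ∧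
      ∃ F' : ℝ × ℝ →L[ℝ] ℂ, HasFDerivAt (fun p => value τ p a) F' p ∧
        ∀ v, F' v = value τ p (space v a) := by
  let d : ℕ × (ℤ × ℤ) → ℂ := fun q =>
    (τ : ℂ) ^ q.1 * (coeff q.1 a).coeff q.2 * Complex.exp (phase q.2 p)
  let L : ℕ × (ℤ × ℤ) → ℝ × ℝ →L[ℝ] ℂ := fun q => phase q.2
  have h : Summable fun q => ‖d q‖ * Real.exp ‖L q‖ := by
    refine Summable.of_nonneg_of_le (fun q => by positivity) (fun q => ?_) (summable_term hτ ha)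
    simp only [d, L]
    rw [norm_mul, norm_exp_phase, mul_one]
    gcongr
    exact norm_phase_le q.2
  have hF : ∀ x, value τ (p + x) a = ∑' q, d q * Complex.exp (L q x) := fun x =>
    tsum_congr fun q => by rw [map_add, Complex.exp_add, ← mul_assoc]
  refine ⟨(hasFPowerSeriesOnBall_expSum (F := fun p => value τ p a) h hF).analyticAt, ?_⟩
  obtain ⟨F', hF', hF'v⟩ := hasFDerivAt_expSum (F := fun p => value τ p a) h hF
  refine ⟨F', hF', fun v => (hF'v v).trans (tsum_congr fun q => ?_)⟩
  rw [coeff_space, TrigPoly.coeff_deriv]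
  ring

/-- The real series of finite norm. -/
noncomputable def convergent (τ : ℝ≥0) : Subring Series where
  carrier := {a | norm τ a ≠ ⊤ ∧ IsReal a}
  zero_mem' := ⟨by simp [norm, TrigPoly.wnorm_zero], fun n => TrigPoly.isReal_zero⟩
  one_mem' := by
    rw [← map_one C]
    exact ⟨ne_top_of_le_ne_top (TrigPoly.wnorm_ne_top (fun _ => ENNReal.ofReal_ne_top) 1)
      (norm_C_le _ _), IsReal.C fun p => by simp⟩
  add_mem' ha hb := ⟨ne_top_of_le_ne_top (ENNReal.add_ne_top.2 ⟨ha.1, hb.1⟩) (norm_add_le _ _ _),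
    ha.2.add hb.2⟩
  mul_mem' ha hb := ⟨ne_top_of_le_ne_top (ENNReal.mul_ne_top ha.1 hb.1)
      (norm_mul_le τ.coe_nonneg _ _),
    ha.2.mul hb.2⟩
  neg_mem' ha := ⟨by rw [norm_neg]; exact ha.1, ha.2.neg⟩

/-- Evaluation of real convergent series. -/
noncomputable def evalHom (τ : ℝ≥0) (p : ℝ × ℝ) : convergent τ →+* ℝ where
  toFun a := (value τ p a).re
  map_one' := by
    rw [OneMemClass.coe_one, ← map_one C, value_C]
    simp
  map_zero' := by simp [value]
  map_add' a b := by
    rw [Subring.coe_add, value_add τ.coe_nonneg p a.2.1 b.2.1, Complex.add_re]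
  map_mul' a b := by
    rw [Subring.coe_mul, value_mul τ.coe_nonneg p a.2.1 b.2.1, Complex.mul_re,
      value_im τ.coe_nonneg p a.2.1 a.2.2, zero_mul, sub_zero]

lemma evalHom_apply {τ : ℝ≥0} (p : ℝ × ℝ) (a : convergent τ) :
    evalHom τ p a = (value τ p a).re := rfl

lemma evalHom_periodic {τ : ℝ≥0} (a : convergent τ) : DoublyPeriodic fun p => evalHom τ p a :=
  fun x y => ⟨congrArg Complex.re (value_periodic τ x y a).1,
    congrArg Complex.re (value_periodic τ x y a).2⟩

lemma analyticOnNhd_evalHom {τ : ℝ≥0} (a : convergent τ) :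
    AnalyticOnNhd ℝ (fun p => evalHom τ p a) univ := fun p _ =>
  (Complex.reCLM.analyticAt _).comp (analyticAt_value τ.coe_nonneg a.2.1 p).1

lemma fderiv_evalHom {τ : ℝ≥0} {a b : convergent τ} {v : ℝ × ℝ} (h : space v (a : Series) = b)
    (p : ℝ × ℝ) : fderiv ℝ (fun p => evalHom τ p a) p v = evalHom τ p b := by
  obtain ⟨F', hF', hF'v⟩ := (analyticAt_value τ.coe_nonneg a.2.1 p).2
  have h' : HasFDerivAt (fun p => evalHom τ p a) (Complex.reCLM.comp F') p :=
    Complex.reCLM.hasFDerivAt.comp p hF'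
  rw [h'.fderiv, evalHom_apply, ← h]
  exact congrArg Complex.re (hF'v v)

end Series

namespace Series

open PowerSeries

open scoped NNReal

lemma value_prim_C {τ : ℝ} (hτ : 0 ≤ τ) (p : ℝ × ℝ) (r : TrigPoly) :
    norm τ (prim (C r)) ≠ ⊤ ∧ value τ p (prim (C r)) = τ * TrigPoly.eval p r := by
  have hC : norm τ (C r) ≠ ⊤ :=
    ne_top_of_le_ne_top (TrigPoly.wnorm_ne_top (fun _ => ENNReal.ofReal_ne_top) r) (norm_C_le τ r)
  have hn : norm τ (prim (C r)) ≠ ⊤ :=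
    ne_top_of_le_ne_top (ENNReal.mul_ne_top ENNReal.ofReal_ne_top hC) (norm_prim_le hτ _)
  refine ⟨hn, (hasSum_value hτ p hn).unique ?_⟩
  have h := hasSum_single (f := fun n => (τ : ℂ) ^ n * TrigPoly.eval p (coeff n (prim (C r)))) 1
    fun n hn => by
      cases n with
      | zero => simp
      | succ n =>
        have hn0 : n ≠ 0 := fun h => hn (by rw [h])
        simp [coeff_succ_prim, coeff_C, hn0]
  simpa [coeff_prim] using h

/-- The leading term in `τ` of the second derivatives of the time primitive. -/
lemma abs_value_prim_space_space_sub_le {τ : ℝ} (hτ : 0 ≤ τ) {v : ℝ × ℝ} (hv : ‖v‖ ≤ 1)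
    (p : ℝ × ℝ) {a b : Series} {r : TrigPoly} (ha : C r + prim b = a) {m : ℝ} (hm : 0 ≤ m)
    (hb : norm τ b ≤ ENNReal.ofReal m) :
    |(value τ p (prim (space v (space v a)))).re -
      τ * (TrigPoly.eval p (TrigPoly.deriv v (TrigPoly.deriv v r))).re| ≤ τ ^ 2 * m := by
  obtain ⟨hn, hval⟩ := value_prim_C hτ p (TrigPoly.deriv v (TrigPoly.deriv v r))
  have hrem : norm τ (prim (space v (prim (space v b)))) ≤ ENNReal.ofReal (τ ^ 2 * m) := by
    refine (norm_prim_space_le hτ hv _).trans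
      ((mul_le_mul_right ((norm_prim_space_le hτ hv _).trans (mul_le_mul_right hb _)) _).trans ?_)
    rw [← ENNReal.ofReal_mul hτ, ← ENNReal.ofReal_mul hτ, sq, mul_assoc]
  have hsplit : prim (space v (space v a)) =
      prim (C (TrigPoly.deriv v (TrigPoly.deriv v r))) + prim (space v (prim (space v b))) := by
    rw [← ha, map_add, map_add, map_add, space_C, space_C, space_prim]
  rw [hsplit, value_add hτ p hn (ne_top_of_le_ne_top ENNReal.ofReal_ne_top hrem), hval,
    Complex.add_re, Complex.re_ofReal_mul, add_sub_cancel_left]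
  exact (Complex.abs_re_le_norm _).trans
    ((ENNReal.ofReal_le_ofReal_iff (by positivity)).1 ((norm_value_le hτ p _).trans hrem))

lemma system9_evalHom {τ : ℝ≥0} {f g l u fx fy gx gy lx ly ux uy : convergent τ}
    (hfx : space (1, 0) (f : Series) = fx) (hfy : space (0, 1) (f : Series) = fy)
    (hgx : space (1, 0) (g : Series) = gx) (hgy : space (0, 1) (g : Series) = gy)
    (hlx : space (1, 0) (l : Series) = lx) (hly : space (0, 1) (l : Series) = ly)
    (hux : space (1, 0) (u : Series) = ux) (huy : space (0, 1) (u : Series) = uy)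
    (e₁ : fx + gy = 0) (e₂ : f * lx + fx * l - (g * ly + gy * l) = 0)
    (e₃ : 2 * ux + 4 * lx - g * (fy - gx) = 0) (e₄ : -(2 * uy) + 4 * ly + f * (fy - gx) = 0) :
    System9 (fun p => evalHom τ p l) (fun p => evalHom τ p u) (fun p => evalHom τ p f)
      fun p => evalHom τ p g := by
  intro p
  have hfl : pX (fun p => evalHom τ p f * evalHom τ p l) p = evalHom τ p (f * lx + fx * l) := by
    simp only [← map_mul]
    refine fderiv_evalHom (v := (1, 0)) ?_ p
    rw [Subring.coe_mul, space_mul, hfx, hlx, Subring.coe_add, Subring.coe_mul, Subring.coe_mul]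
  have hgl : pY (fun p => evalHom τ p g * evalHom τ p l) p = evalHom τ p (g * ly + gy * l) := by
    simp only [← map_mul]
    refine fderiv_evalHom (v := (0, 1)) ?_ p
    rw [Subring.coe_mul, space_mul, hgy, hly, Subring.coe_add, Subring.coe_mul, Subring.coe_mul]
  have e₃' := congrArg (evalHom τ p) e₃
  have e₄' := congrArg (evalHom τ p) e₄
  simp only [map_add, map_sub, map_neg, map_mul, map_ofNat, map_zero] at e₃' e₄'
  rw [hfl, hgl, ← map_sub, e₂, map_zero]
  simp only [pX, pY, fderiv_evalHom hfx, fderiv_evalHom hfy, fderiv_evalHom hgx,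
    fderiv_evalHom hgy, fderiv_evalHom hlx, fderiv_evalHom hly, fderiv_evalHom hux,
    fderiv_evalHom huy]
  refine ⟨by rw [← map_add, e₁, map_zero], trivial, by linarith, by linarith⟩

end Series

open scoped NNReal in
lemma exists_pos_mul_le (m : ℝ≥0) {η l : ℝ} (hη : 0 < η) (hl : 0 < l) :
    ∃ τ : ℝ≥0, 0 < (τ : ℝ) ∧ τ * m ≤ (1 : ℝ) ∧ τ * m ≤ η ∧ 2 * (τ * m) < l := by
  set κ := min 1 (min η (l / 4))
  have hκ0 : 0 < κ := by positivity
  have hκm : κ / (m + 1) * m ≤ κ := by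
    rw [div_mul_eq_mul_div, div_le_iff₀ (by positivity)]
    nlinarith
  refine ⟨⟨κ / (m + 1), by positivity⟩, ?_, ?_, ?_, ?_⟩
  · change 0 < κ / (m + 1)
    positivity
  · exact hκm.trans (min_le_left _ _)
  · exact hκm.trans ((min_le_right _ _).trans (min_le_left _ _))
  · have h : κ / (m + 1) * m ≤ l / 4 :=
      hκm.trans ((min_le_right _ _).trans (min_le_right _ _))
    change 2 * (κ / (m + 1) * m) < l
    linarith

open scoped NNReal in
open PowerSeries Series in
/-- Perturbation of a Liouville metric with trigonometric polynomial coefficients. -/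
lemma exists_solution {r₁ r₂ : TrigPoly} (hr₁ : r₁.IsReal) (hr₂ : r₂.IsReal)
    (h₁ : TrigPoly.deriv (0, 1) r₁ = 0) (h₂ : TrigPoly.deriv (1, 0) r₂ = 0) {q : ℝ × ℝ}
    (hq : (TrigPoly.eval q (TrigPoly.deriv (1, 0) (TrigPoly.deriv (1, 0) (2 * r₂ - 2 * r₁)))).re +
      (TrigPoly.eval q (TrigPoly.deriv (0, 1) (TrigPoly.deriv (0, 1) (2 * r₂ - 2 * r₁)))).re ≠ 0)
    {η : ℝ} (hη : 0 < η) :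
    ∃ Λ u₀ f g : ℝ × ℝ → ℝ,
      AnalyticOnNhd ℝ Λ univ ∧ AnalyticOnNhd ℝ u₀ univ ∧
      AnalyticOnNhd ℝ f univ ∧ AnalyticOnNhd ℝ g univ ∧
      DoublyPeriodic Λ ∧ DoublyPeriodic u₀ ∧ DoublyPeriodic f ∧ DoublyPeriodic g ∧
      System9 Λ u₀ f g ∧ pX g q - pY f q ≠ 0 ∧
      (∀ p, |Λ p - ((TrigPoly.eval p r₁).re + (TrigPoly.eval p r₂).re)| ≤ η) ∧
      (∀ p, |u₀ p - (2 * (TrigPoly.eval p r₂).re - 2 * (TrigPoly.eval p r₁).re)| ≤ η) ∧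
      (∀ p, |f p| ≤ η) ∧ ∀ p, |g p| ≤ η := by
  set U₀ : Fin 4 → TrigPoly := ![0, 0, r₁ + r₂, 2 * r₂ - 2 * r₁] with hU₀
  have h2 : ∀ r : TrigPoly, r.IsReal → (2 * r).IsReal := fun r hr => by
    rw [two_mul]
    exact hr.add hr
  have hU₀r : ∀ i, (U₀ i).IsReal := by
    intro i
    fin_cases i
    · exact TrigPoly.isReal_zero
    · exact TrigPoly.isReal_zero
    · exact hr₁.add hr₂
    · exact (h2 _ hr₂).sub (h2 _ hr₁)
  obtain ⟨U, hU, hUr, B, hB, hbd⟩ := exists_step_eq U₀ hU₀r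
  set l : ℝ := (TrigPoly.eval q (TrigPoly.deriv (1, 0)
      (TrigPoly.deriv (1, 0) (2 * r₂ - 2 * r₁)))).re +
    (TrigPoly.eval q (TrigPoly.deriv (0, 1) (TrigPoly.deriv (0, 1) (2 * r₂ - 2 * r₁)))).re with hl
  have hM : 10 * B ^ 2 ≠ ⊤ := ENNReal.mul_ne_top (by norm_num) (ENNReal.pow_ne_top hB)
  obtain ⟨m, hm⟩ : ∃ m : ℝ≥0, 10 * B ^ 2 = m := ⟨_, (ENNReal.coe_toNNReal hM).symm⟩
  have hm' : (m : ℝ≥0∞) = ENNReal.ofReal m := (ENNReal.ofReal_coe_nnreal).symm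
  rw [hm, hm'] at hbd
  have hm0 : (0 : ℝ) ≤ m := m.coe_nonneg
  obtain ⟨τ, hτ0, hτ1, hτη, hτl⟩ := exists_pos_mul_le m hη (abs_pos.2 hq)
  have hτ : (0 : ℝ) ≤ τ := τ.coe_nonneg
  have hb := hbd τ hτ (by
    rw [← ENNReal.ofReal_mul hτ, ← ENNReal.ofReal_one]
    exact ENNReal.ofReal_le_ofReal hτ1)
  have hfin : ∀ {a : Series} {b : ℝ≥0∞}, b ≠ ⊤ → norm τ a ≤ b → norm τ a ≠ ⊤ :=
    fun hb hab => ne_top_of_le_ne_top hb hab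
  obtain ⟨V, hV⟩ : ∃ V : Fin 4 → convergent τ, ∀ i, (V i : Series) = U i :=
    ⟨fun i => ⟨U i, hfin hB (hb i).1, hUr i⟩, fun _ => rfl⟩
  obtain ⟨Vx, hVx⟩ : ∃ V : Fin 4 → convergent τ, ∀ i, space (1, 0) (U i) = V i :=
    ⟨fun i => ⟨_, hfin hB (hb i).2.1, (hUr i).space _⟩, fun _ => rfl⟩
  obtain ⟨Vy, hVy⟩ : ∃ V : Fin 4 → convergent τ, ∀ i, space (0, 1) (U i) = V i :=
    ⟨fun i => ⟨_, hfin hB (hb i).2.2.1, (hUr i).space _⟩, fun _ => rfl⟩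
  have hx : ∀ i, space (1, 0) (V i : Series) = Vx i := fun i => by rw [hV, hVx]
  have hy : ∀ i, space (0, 1) (V i : Series) = Vy i := fun i => by rw [hV, hVy]
  have htwo : ((2 : convergent τ) : Series) = 2 := map_ofNat (convergent τ).subtype 2
  have hfour : ((4 : convergent τ) : Series) = 4 := map_ofNat (convergent τ).subtype 4
  obtain ⟨e₁, e₂, e₃, e₄⟩ := step_eq_equations h₁ h₂ hU
  rw [space_mul, space_mul] at e₂
  simp only [← hV] at e₁ e₂ e₃ e₄
  simp only [hx, hy] at e₁ e₂ e₃ e₄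
  rw [← htwo, ← hfour] at e₃ e₄
  have hi : ∀ i, C (U₀ i) + prim (velocity U i) = U i := fun i => congrFun hU i
  have hclose : ∀ i p, |evalHom τ p (V i) - (TrigPoly.eval p (U₀ i)).re| ≤ η := fun i p => by
    have hn : norm τ (prim (velocity U i)) ≤ ENNReal.ofReal (τ * m) := by
      rw [ENNReal.ofReal_mul hτ]
      exact (norm_prim_le hτ _).trans (mul_le_mul_right (hb i).2.2.2 _)
    have hC : norm τ (C (U₀ i)) ≠ ⊤ := hfin
      (TrigPoly.wnorm_ne_top (fun _ => ENNReal.ofReal_ne_top) _) (norm_C_le _ _)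
    have hv : value τ p (U i) = TrigPoly.eval p (U₀ i) + value τ p (prim (velocity U i)) := by
      rw [← value_C τ p (U₀ i), ← value_add hτ p hC (hfin ENNReal.ofReal_ne_top hn), hi i]
    rw [evalHom_apply, hV, hv, Complex.add_re, add_sub_cancel_left]
    refine le_trans ?_ hτη
    exact (Complex.abs_re_le_norm _).trans
      ((ENNReal.ofReal_le_ofReal_iff (by positivity)).1 ((norm_value_le hτ p _).trans hn))
  refine ⟨fun p => evalHom τ p (V 2), fun p => evalHom τ p (V 3), fun p => evalHom τ p (V 0),
    fun p => evalHom τ p (V 1), analyticOnNhd_evalHom _, analyticOnNhd_evalHom _,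
    analyticOnNhd_evalHom _, analyticOnNhd_evalHom _, evalHom_periodic _, evalHom_periodic _,
    evalHom_periodic _, evalHom_periodic _,
    system9_evalHom (hx 0) (hy 0) (hx 1) (hy 1) (hx 2) (hy 2) (hx 3) (hy 3) (Subtype.ext e₁)
      (Subtype.ext e₂) (Subtype.ext e₃) (Subtype.ext e₄), ?_, fun p => ?_,
    fun p => ?_, fun p => ?_, fun p => ?_⟩
  · have hW : ∀ v : ℝ × ℝ, ‖v‖ ≤ 1 → norm τ (space v (U 3)) ≤ B →
        prim (space v (space v (U 3))) ∈ convergent τ := fun v hv hB' =>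
      ⟨hfin (ENNReal.mul_ne_top ENNReal.ofReal_ne_top hB)
        ((norm_prim_space_le hτ hv _).trans (mul_le_mul_right hB' _)),
        (((hUr 3).space v).space v).prim⟩
    obtain ⟨Wx, hWx⟩ : ∃ W : convergent τ,
        (W : Series) = prim (space (1, 0) (space (1, 0) (U 3))) :=
      ⟨⟨_, hW (1, 0) (by simp) (hb 3).2.1⟩, rfl⟩
    obtain ⟨Wy, hWy⟩ : ∃ W : convergent τ,
        (W : Series) = prim (space (0, 1) (space (0, 1) (U 3))) :=
      ⟨⟨_, hW (0, 1) (by simp) (hb 3).2.2.1⟩, rfl⟩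
    have hgx : Vx 1 = -(2 * Wx) := by
      refine Subtype.ext ?_
      have h : prim (-(2 * space (1, 0) (U 3))) = U 1 := by simpa [velocity, U₀] using hi 1
      rw [← hVx, ← h, space_prim, map_neg, map_neg, space_two_mul, Subring.coe_neg,
        Subring.coe_mul, htwo, hWx, two_mul, map_add, two_mul]
    have hfy : Vy 0 = 2 * Wy := by
      refine Subtype.ext ?_
      have h : prim (2 * space (0, 1) (U 3)) = U 0 := by simpa [velocity, U₀] using hi 0
      rw [← hVy, ← h, space_prim, space_two_mul, Subring.coe_mul, htwo, hWy, two_mul, map_add,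
        two_mul]
    have hx' := abs_value_prim_space_space_sub_le hτ (v := (1, 0)) (by simp) q (hi 3) hm0
      (hb 3).2.2.2
    have hy' := abs_value_prim_space_space_sub_le hτ (v := (0, 1)) (by simp) q (hi 3) hm0
      (hb 3).2.2.2
    rw [← hWx, ← evalHom_apply] at hx'
    rw [← hWy, ← evalHom_apply] at hy'
    rw [pX, pY, fderiv_evalHom (hx 1), fderiv_evalHom (hy 0), hgx, hfy, map_neg, map_mul,
      map_mul, map_ofNat]
    intro h0
    have hsum : evalHom τ q Wx + evalHom τ q Wy = 0 := by linarith
    have hle : |(τ : ℝ) * l| ≤ τ * (2 * (τ * m)) := by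
      have h3 : U₀ 3 = 2 * r₂ - 2 * r₁ := rfl
      rw [h3] at hx' hy'
      have he := abs_add_le (evalHom τ q Wx - τ * (TrigPoly.eval q (TrigPoly.deriv (1, 0)
          (TrigPoly.deriv (1, 0) (2 * r₂ - 2 * r₁)))).re)
        (evalHom τ q Wy - τ * (TrigPoly.eval q (TrigPoly.deriv (0, 1)
          (TrigPoly.deriv (0, 1) (2 * r₂ - 2 * r₁)))).re)
      rw [sub_add_sub_comm, hsum, zero_sub, ← mul_add, abs_neg] at he
      refine (he.trans (add_le_add hx' hy')).trans (le_of_eq ?_)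
      ring
    rw [abs_mul, abs_of_pos hτ0] at hle
    exact absurd (le_of_mul_le_mul_left hle hτ0) (not_le.2 hτl)
  · have h := hclose 2 p
    change |_ - (TrigPoly.eval p (r₁ + r₂)).re| ≤ η at h
    rwa [map_add, Complex.add_re] at h
  · have h := hclose 3 p
    change |_ - (TrigPoly.eval p (2 * r₂ - 2 * r₁)).re| ≤ η at h
    rw [map_sub, map_mul, map_mul, map_ofNat] at h
    simpa using h
  · have h := hclose 0 p
    change |_ - (TrigPoly.eval p 0).re| ≤ η at h
    simpa using h
  · have h := hclose 1 p
    change |_ - (TrigPoly.eval p 0).re| ≤ η at h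
    simpa using h

namespace TrigPoly

open scoped ComplexConjugate

/-- Uniform approximation of a continuous periodic function of one linear coordinate. -/
lemma exists_abs_eval_sub_lt {coord : ℝ × ℝ → ℝ} {ι : ℤ → ℤ × ℤ} {v : ℝ × ℝ}
    (hι : ∀ n p, phase (ι n) p = 2 * π * Complex.I * n * coord p) (hv : ∀ n, phase (ι n) v = 0)
    {h : ℝ → ℝ} (hc : Continuous h) (hp : Function.Periodic h 1) {δ : ℝ} (hδ : 0 < δ) :
    ∃ r : TrigPoly, r.IsReal ∧ deriv v r = 0 ∧ ∀ p, |(eval p r).re - h (coord p)| < δ := by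
  have : Fact ((0 : ℝ) < 1) := ⟨one_pos⟩
  let Q : C(AddCircle (1 : ℝ), ℂ) → Prop := fun q => ∃ r s : TrigPoly,
    deriv v r = 0 ∧ deriv v s = 0 ∧
      ∀ p, eval p r = q (coord p : ℝ) ∧ eval p s = conj (q (coord p : ℝ))
  have hQ : ∀ q ∈ Submodule.span ℂ (range <| @fourier (1 : ℝ)), Q q := fun q hq => by
    induction hq using Submodule.span_induction with
    | mem q hq =>
      obtain ⟨n, rfl⟩ := hq
      refine ⟨AddMonoidAlgebra.single (ι n) 1, AddMonoidAlgebra.single (ι (-n)) 1,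
        by simp [deriv_single, hv], by simp [deriv_single, hv], fun p => ?_⟩
      rw [eval_single, eval_single, hι, hι, one_mul, one_mul, ← fourier_neg, fourier_coe_apply,
        fourier_coe_apply, Complex.ofReal_one, div_one, div_one]
      exact ⟨rfl, rfl⟩
    | zero => exact ⟨0, 0, map_zero _, map_zero _, fun p => by simp⟩
    | add a b _ _ ha hb =>
      obtain ⟨r, s, hr, hs, h⟩ := ha
      obtain ⟨r', s', hr', hs', h'⟩ := hb
      exact ⟨r + r', s + s', by rw [map_add, hr, hr', add_zero],
        by rw [map_add, hs, hs', add_zero],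
        fun p => by simp [(h p).1, (h p).2, (h' p).1, (h' p).2]⟩
    | smul c a _ ha =>
      obtain ⟨r, s, hr, hs, h⟩ := ha
      exact ⟨c • r, conj c • s, by rw [deriv_smul, hr, smul_zero],
        by rw [deriv_smul, hs, smul_zero], fun p => by simp [(h p).1, (h p).2]⟩
  let H : C(AddCircle (1 : ℝ), ℂ) :=
    ⟨fun x => (hp.lift x : ℂ), Complex.continuous_ofReal.comp (hc.quotient_lift _)⟩
  have hH : H ∈ (Submodule.span ℂ (range <| @fourier (1 : ℝ))).topologicalClosure := by
    rw [span_fourier_closure_eq_top]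
    trivial
  obtain ⟨q, hq, hd⟩ := Metric.mem_closure_iff.1 hH δ hδ
  obtain ⟨r, s, hr, hs, he⟩ := hQ q hq
  have hval : ∀ p, eval p ((1 / 2 : ℂ) • (r + s)) = ((q (coord p : ℝ)).re : ℂ) := fun p => by
    rw [map_smul, map_add, (he p).1, (he p).2, Complex.add_conj, smul_eq_mul]
    push_cast
    ring
  refine ⟨(1 / 2 : ℂ) • (r + s), fun p => by rw [hval, Complex.ofReal_im],
    by rw [deriv_smul, map_add, hr, hs, add_zero, smul_zero], fun p => ?_⟩
  have h1 : H (coord p : ℝ) = (h (coord p) : ℂ) := rfl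
  have h2 := (ContinuousMap.dist_apply_le_dist (coord p : AddCircle (1 : ℝ))).trans_lt hd
  rw [hval, Complex.ofReal_re, abs_sub_comm, ← Complex.ofReal_re (h (coord p)), ← Complex.sub_re,
    ← h1]
  rw [dist_eq_norm] at h2
  exact (Complex.abs_re_le_norm _).trans_lt h2

/-- A trigonometric polynomial whose derivative is constant on a closed line is constant there. -/
lemma eval_eq_of_deriv {v : ℝ × ℝ} {r : TrigPoly} (hper : eval v r = eval 0 r)
    (h : ∀ s : ℝ, eval (s • v) (deriv v r) = eval 0 (deriv v r)) (s : ℝ) :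
    eval (s • v) r = eval 0 r := by
  set c := eval 0 (deriv v r)
  have hd : ∀ s : ℝ, HasDerivAt (fun s : ℝ => eval (s • v) r - s * c) 0 s := fun s => by
    have h' := (hasDerivAt_eval 0 v r s).sub ((hasDerivAt_id s).ofReal_comp.mul_const c)
    simpa [h, Pi.sub_def] using h'
  have hcst := fun s => is_const_of_deriv_eq_zero (fun s => (hd s).differentiableAt)
    (fun s => (hd s).deriv) s 0
  have hc : c = 0 := by simpa [hper] using hcst 1
  simpa [hc] using hcst s

lemma eval_one_zero (r : TrigPoly) : eval (1, 0) r = eval 0 r := by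
  simpa [Series.value_C, Prod.zero_eq_mk] using (Series.value_periodic 0 0 0 (PowerSeries.C r)).1

/-- The Laplacian of a nonconstant sum of functions of single variables is not zero. -/
lemma exists_laplacian_ne_zero {r₁ r₂ : TrigPoly} (hr₁ : r₁.IsReal) (hr₂ : r₂.IsReal)
    (h₁ : deriv (0, 1) r₁ = 0) (h₂ : deriv (1, 0) r₂ = 0) {a b : ℝ}
    (hab : (eval (a, 0) r₁).re ≠ (eval (b, 0) r₁).re) :
    ∃ q, (eval q (deriv (1, 0) (deriv (1, 0) (2 * r₂ - 2 * r₁)))).re +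
      (eval q (deriv (0, 1) (deriv (0, 1) (2 * r₂ - 2 * r₁)))).re ≠ 0 := by
  by_contra! H
  set w := deriv (0, 1) (deriv (0, 1) r₂) with hw
  have hwr : w.IsReal := (hr₂.deriv _).deriv _
  have hdr : (deriv (1, 0) (deriv (1, 0) r₁)).IsReal := (hr₁.deriv _).deriv _
  have hxw : deriv (1, 0) w = 0 := by
    rw [hw, deriv_comm, deriv_comm (1, 0), h₂, map_zero, map_zero]
  have heq : ∀ q, eval q (deriv (1, 0) (deriv (1, 0) r₁)) = eval q w := fun q => by
    have h := H q
    simp only [two_mul, map_sub, map_add, h₁, h₂, ← hw, map_zero] at h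
    refine Complex.ext ?_ ?_
    · simp only [Complex.add_re, Complex.sub_re, Complex.zero_re] at h
      linarith
    · rw [hwr, hdr]
  have hw' : ∀ s : ℝ, eval (s • ((1, 0) : ℝ × ℝ)) w = eval 0 w :=
    eval_eq_of_deriv (eval_one_zero _) fun s => by rw [hxw, map_zero, map_zero]
  have hr : ∀ s : ℝ, eval (s • ((1, 0) : ℝ × ℝ)) r₁ = eval 0 r₁ :=
    eval_eq_of_deriv (eval_one_zero _) (eval_eq_of_deriv (eval_one_zero _) fun s => by
      rw [heq, heq, hw'])
  have ha := hr a
  have hb := hr b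
  simp only [Prod.smul_mk, smul_eq_mul, mul_one, mul_zero] at ha hb
  exact hab (by rw [ha, hb])

end TrigPoly

/-- A positive continuous periodic function is bounded below by a positive constant. -/
lemma exists_pos_forall_le {h : ℝ → ℝ} (hc : Continuous h) (hp : Function.Periodic h 1)
    (hpos : ∀ x, 0 < h x) : ∃ c, 0 < c ∧ ∀ x, c ≤ h x := by
  obtain ⟨x₀, -, hx₀⟩ := isCompact_Icc.exists_isMinOn (nonempty_Icc.2 zero_le_one) hc.continuousOn
  refine ⟨h x₀, hpos x₀, fun x => ?_⟩
  obtain ⟨y, hy, hxy⟩ := hp.exists_mem_Ico₀ one_pos x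
  rw [hxy]
  exact hx₀ (Ico_subset_Icc_self hy)

end MagneticTorus

/-- Any pair of positive analytic `1`-periodic functions `Λ₁, Λ₂` with
`Λ₁` nonconstant (i.e. the Liouville metric `Λ₁(x) + Λ₂(y)` with zero magnetic field) can be
approximated arbitrarily well by analytic doubly periodic solutions of system (9) whose
magnetic field `Ω = (g_x - f_y)/4` is not identically zero. -/
theorem statement0
    (Λ₁ Λ₂ : ℝ → ℝ)
    (hΛ₁a : AnalyticOnNhd ℝ Λ₁ univ) (hΛ₂a : AnalyticOnNhd ℝ Λ₂ univ)
    (hΛ₁pos : ∀ x, 0 < Λ₁ x) (hΛ₂pos : ∀ y, 0 < Λ₂ y)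
    (hΛ₁per : Function.Periodic Λ₁ 1) (hΛ₂per : Function.Periodic Λ₂ 1)
    (hΛ₁nc : ∃ a b : ℝ, Λ₁ a ≠ Λ₁ b)
    (ε : ℝ) (hε : 0 < ε) :
    ∃ Λ u₀ f g : ℝ × ℝ → ℝ,
      AnalyticOnNhd ℝ Λ univ ∧ AnalyticOnNhd ℝ u₀ univ ∧
      AnalyticOnNhd ℝ f univ ∧ AnalyticOnNhd ℝ g univ ∧
      DoublyPeriodic Λ ∧ DoublyPeriodic u₀ ∧ DoublyPeriodic f ∧ DoublyPeriodic g ∧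
      (∀ p : ℝ × ℝ, 0 < Λ p) ∧
      System9 Λ u₀ f g ∧
      (∃ p : ℝ × ℝ, pX g p - pY f p ≠ 0) ∧
      (∀ p : ℝ × ℝ, |Λ p - (Λ₁ p.1 + Λ₂ p.2)| < ε) ∧
      (∀ p : ℝ × ℝ, |u₀ p - (2 * Λ₂ p.2 - 2 * Λ₁ p.1)| < ε) ∧
      (∀ p : ℝ × ℝ, |f p| < ε) ∧
      (∀ p : ℝ × ℝ, |g p| < ε) := by
  obtain ⟨a, b, hab⟩ := hΛ₁nc
  have hΛ₁c : Continuous Λ₁ := continuousOn_univ.1 hΛ₁a.continuousOn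
  have hΛ₂c : Continuous Λ₂ := continuousOn_univ.1 hΛ₂a.continuousOn
  obtain ⟨c, hc, hcle⟩ := MagneticTorus.exists_pos_forall_le hΛ₁c hΛ₁per hΛ₁pos
  have hab' : 0 < |Λ₁ a - Λ₁ b| := abs_pos.2 (sub_ne_zero.2 hab)
  set ε' := min ε c
  have hε' : 0 < ε' := lt_min hε hc
  have hεε' : ε' ≤ ε := min_le_left _ _
  have hcε' : ε' ≤ c := min_le_right _ _
  obtain ⟨δ, hδ, hδε, hδab⟩ : ∃ δ, 0 < δ ∧ δ ≤ ε' / 8 ∧ δ ≤ |Λ₁ a - Λ₁ b| / 2 :=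
    ⟨min (ε' / 8) (|Λ₁ a - Λ₁ b| / 2), by positivity, min_le_left _ _, min_le_right _ _⟩
  obtain ⟨r₁, hr₁, hd₁, h₁⟩ := MagneticTorus.TrigPoly.exists_abs_eval_sub_lt (coord := Prod.fst)
    (ι := fun n => (n, 0)) (v := (0, 1)) (fun n p => by simp [MagneticTorus.phase])
    (fun n => by simp [MagneticTorus.phase]) hΛ₁c hΛ₁per hδ
  obtain ⟨r₂, hr₂, hd₂, h₂⟩ := MagneticTorus.TrigPoly.exists_abs_eval_sub_lt (coord := Prod.snd)
    (ι := fun n => (0, n)) (v := (1, 0)) (fun n p => by simp [MagneticTorus.phase])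
    (fun n => by simp [MagneticTorus.phase]) hΛ₂c hΛ₂per hδ
  obtain ⟨q, hq⟩ := MagneticTorus.TrigPoly.exists_laplacian_ne_zero hr₁ hr₂ hd₁ hd₂ (a := a)
    (b := b) fun h => by
      have ha := h₁ (a, 0)
      have hb := h₁ (b, 0)
      rw [h, abs_sub_comm] at ha
      have hab'' := abs_sub_le (Λ₁ a) (MagneticTorus.TrigPoly.eval (b, 0) r₁).re (Λ₁ b)
      linarith
  obtain ⟨Λ, u₀, f, g, hΛ, hu, hf, hg, pΛ, pu, pf, pg, hS, hΩ, cΛ, cu, cf, cg⟩ :=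
    MagneticTorus.exists_solution hr₁ hr₂ hd₁ hd₂ hq (η := ε' / 4) (by positivity)
  have hclose : ∀ p : ℝ × ℝ, |Λ p - (Λ₁ p.1 + Λ₂ p.2)| < ε' := fun p => by
    have := abs_lt.1 (h₁ p)
    have := abs_lt.1 (h₂ p)
    have := abs_le.1 (cΛ p)
    refine abs_lt.2 ⟨?_, ?_⟩ <;> linarith
  refine ⟨Λ, u₀, f, g, hΛ, hu, hf, hg, pΛ, pu, pf, pg, fun p => ?_, hS, ⟨q, hΩ⟩,
    fun p => (hclose p).trans_le hεε', fun p => ?_, fun p => ?_, fun p => ?_⟩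
  · have := (abs_lt.1 (hclose p)).1
    have := hcle p.1
    have := hΛ₂pos p.2
    linarith
  · have := abs_lt.1 (h₁ p)
    have := abs_lt.1 (h₂ p)
    have := abs_le.1 (cu p)
    refine abs_lt.2 ⟨?_, ?_⟩ <;> linarith
  · exact (cf p).trans_lt (by linarith)
  · exact (cg p).trans_lt (by linarith)
end

section
/- Let Λ, u₀, f, g: ℝ² → ℝ be continuously differentiable with Λ > 0 everywhere, satisfying system (9), and set Ω = (1/4)(g_x − f_y). Define F(x,y,φ) = u₀(x,y) + 2√(Λ(x,y))·(f(x,y)·cos φ − g(x,y)·sin φ) + 2Λ(x,y)·cos 2φ. If (x(t), y(t), φ(t)) is a differentiable solution on an interval I ⊆ ℝ of the ODE system x' = cos φ / √Λ, y' = sin φ / √Λ, φ' = (Λ_y cos φ − Λ_x sin φ)/(2Λ√Λ) − Ω/Λ, then the function t ↦ F(x(t), y(t), φ(t)) is constant on I. -/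
open Set Real

/-- Chain rule along a plane curve, in terms of the partial derivatives `pX`, `pY`. -/
theorem hasDerivAt_comp_curve {h : ℝ × ℝ → ℝ} {x y : ℝ → ℝ} {t x' y' : ℝ}
    (hh : DifferentiableAt ℝ h (x t, y t)) (hx : HasDerivAt x x' t) (hy : HasDerivAt y y' t) :
    HasDerivAt (fun τ => h (x τ, y τ)) (pX h (x t, y t) * x' + pY h (x t, y t) * y') t := by
  have key := hh.hasFDerivAt.comp_hasDerivAt t (hx.prodMk hy)
  have hv : ((x', y') : ℝ × ℝ) = x' • ((1, 0) : ℝ × ℝ) + y' • ((0, 1) : ℝ × ℝ) := by simp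
  rw [hv, map_add, map_smul, map_smul, smul_eq_mul, smul_eq_mul] at key
  exact key.congr_deriv (by simp only [pX, pY]; ring)

theorem pX_mul {h k : ℝ × ℝ → ℝ} {p : ℝ × ℝ} (hh : DifferentiableAt ℝ h p)
    (hk : DifferentiableAt ℝ k p) :
    pX (fun q => h q * k q) p = h p * pX k p + k p * pX h p := by
  simp [pX, fderiv_fun_mul hh hk]

theorem pY_mul {h k : ℝ × ℝ → ℝ} {p : ℝ × ℝ} (hh : DifferentiableAt ℝ h p)
    (hk : DifferentiableAt ℝ k p) :
    pY (fun q => h q * k q) p = h p * pY k p + k p * pY h p := by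
  simp [pY, fderiv_fun_mul hh hk]

/-- The derivative of the first integral along the flow vanishes; here `r` is `√Λ`, `c` and `n` are
the cosine and the sine of the angle, and the remaining variables are values of the coefficients and
of their partial derivatives. -/
theorem flow_derivative_eq_zero {r c n f g Λx Λy ux uy fx fy gx gy : ℝ} (hr : r ≠ 0)
    (hcn : c ^ 2 + n ^ 2 = 1) (h₁ : fx + gy = 0)
    (h₂ : f * Λx + r ^ 2 * fx - (g * Λy + r ^ 2 * gy) = 0)
    (h₃ : ux + 2 * Λx - (1/2) * g * (fy - gx) = 0)
    (h₄ : -uy + 2 * Λy + (1/2) * f * (fy - gx) = 0) :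
    ux * (c / r) + uy * (n / r)
      + (2 * ((Λx * (c / r) + Λy * (n / r)) / (2 * r)) * (f * c - g * n)
        + 2 * r * ((fx * (c / r) + fy * (n / r)) * c
            + f * (-n * ((Λy * c - Λx * n) / (2 * r ^ 2 * r) - (1/4) * (gx - fy) / r ^ 2))
          - ((gx * (c / r) + gy * (n / r)) * n
            + g * (c * ((Λy * c - Λx * n) / (2 * r ^ 2 * r) - (1/4) * (gx - fy) / r ^ 2)))))
      + (2 * (Λx * (c / r) + Λy * (n / r)) * (2 * c ^ 2 - 1)
        + 2 * r ^ 2 * (-(2 * n * c)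
          * (2 * ((Λy * c - Λx * n) / (2 * r ^ 2 * r) - (1/4) * (gx - fy) / r ^ 2)))) = 0 := by
  obtain rfl : gy = -fx := by linarith
  obtain rfl : ux = -2 * Λx + (1/2) * g * (fy - gx) := by linarith
  obtain rfl : uy = 2 * Λy + (1/2) * f * (fy - gx) := by linarith
  have e : (f * Λx - g * Λy + 2 * r ^ 2 * fx) / r ^ 2 = 0 := by
    rw [div_eq_zero_iff]; left; linarith
  have hcn' : c ^ 2 + n ^ 2 - 1 = 0 := by linarith
  calc _ = (f * Λx - g * Λy + 2 * r ^ 2 * fx) / r ^ 2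
        + (c ^ 2 + n ^ 2 - 1) * ((f * Λx - g * Λy + 2 * r ^ 2 * fx) / r ^ 2 + 4 * Λx * c / r) := by
        field_simp
        ring
    _ = 0 := by rw [e, hcn']; ring

/-- If `Λ, u₀, f, g` is a `C¹` solution of system (9) with `Λ > 0` and
`Ω = (g_x - f_y)/4`, then
`F(x,y,φ) = u₀ + 2√Λ (f cos φ - g sin φ) + 2Λ cos 2φ`
is a first integral of the magnetic geodesic flow on the energy level `H = 1/2`:
it is constant along every solution of the ODE system
`x' = cos φ/√Λ`, `y' = sin φ/√Λ`,
`φ' = (Λ_y cos φ - Λ_x sin φ)/(2Λ√Λ) - Ω/Λ` on an interval `I`. -/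
theorem statement1
    (Λ u₀ f g : ℝ × ℝ → ℝ)
    (hΛ : ContDiff ℝ 1 Λ) (hu₀ : ContDiff ℝ 1 u₀) (hf : ContDiff ℝ 1 f) (hg : ContDiff ℝ 1 g)
    (hΛpos : ∀ p : ℝ × ℝ, 0 < Λ p)
    (hsys : System9 Λ u₀ f g)
    (Ω : ℝ × ℝ → ℝ) (hΩ : ∀ p, Ω p = (1/4) * (pX g p - pY f p))
    (F : ℝ × ℝ → ℝ → ℝ)
    (hF : ∀ (p : ℝ × ℝ) (φ : ℝ),
      F p φ = u₀ p + 2 * Real.sqrt (Λ p) * (f p * Real.cos φ - g p * Real.sin φ)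
        + 2 * Λ p * Real.cos (2 * φ))
    (I : Set ℝ) (hI : Convex ℝ I)
    (x y φ : ℝ → ℝ)
    (hx : ∀ t ∈ I, HasDerivAt x (Real.cos (φ t) / Real.sqrt (Λ (x t, y t))) t)
    (hy : ∀ t ∈ I, HasDerivAt y (Real.sin (φ t) / Real.sqrt (Λ (x t, y t))) t)
    (hφ : ∀ t ∈ I, HasDerivAt φ
      ((pY Λ (x t, y t) * Real.cos (φ t) - pX Λ (x t, y t) * Real.sin (φ t)) /
          (2 * Λ (x t, y t) * Real.sqrt (Λ (x t, y t)))
        - Ω (x t, y t) / Λ (x t, y t)) t) :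
    ∀ s ∈ I, ∀ t ∈ I, F (x s, y s) (φ s) = F (x t, y t) (φ t) := by
  have hderiv : ∀ t ∈ I, HasDerivAt (fun τ => F (x τ, y τ) (φ τ)) 0 t := by
    intro t ht
    have hxt := hx t ht
    have hyt := hy t ht
    have hφt := hφ t ht
    have hpos := hΛpos (x t, y t)
    have dΛ := hΛ.differentiable one_ne_zero (x t, y t)
    have du := hu₀.differentiable one_ne_zero (x t, y t)
    have df := hf.differentiable one_ne_zero (x t, y t)
    have dg := hg.differentiable one_ne_zero (x t, y t)
    obtain ⟨h₁, h₂, h₃, h₄⟩ := hsys (x t, y t)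
    rw [pX_mul df dΛ, pY_mul dg dΛ] at h₂
    have cΛ := hasDerivAt_comp_curve dΛ hxt hyt
    have cu := hasDerivAt_comp_curve du hxt hyt
    have cf := hasDerivAt_comp_curve df hxt hyt
    have cg := hasDerivAt_comp_curve dg hxt hyt
    have key := (cu.add (((cΛ.sqrt hpos.ne').const_mul 2).mul
      ((cf.mul hφt.cos).sub (cg.mul hφt.sin)))).add
      ((cΛ.const_mul 2).mul (hφt.const_mul 2).cos)
    have hsq : √(Λ (x t, y t)) ^ 2 = Λ (x t, y t) := Real.sq_sqrt hpos.le
    rw [← hsq] at h₂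
    have hzero := flow_derivative_eq_zero (Real.sqrt_pos.2 hpos).ne'
      (Real.cos_sq_add_sin_sq (φ t)) h₁ h₂ h₃ h₄
    rw [hsq] at hzero
    simp only [hF]
    refine key.congr_deriv ?_
    rw [← hzero, Real.sin_two_mul, Real.cos_two_mul, hΩ]
    simp only [Pi.mul_apply, Pi.sub_apply]
  intro s hs t ht
  have hle := hI.norm_image_sub_le_of_norm_hasDerivWithin_le (C := 0)
    (fun τ hτ => (hderiv τ hτ).hasDerivWithinAt) (fun _ _ => by simp) ht hs
  rw [zero_mul, norm_le_zero_iff, sub_eq_zero] at hle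
  exact hle
end

section
/- Let Λ, a₀, a₂, f, g, c₀, Ω: ℝ² → ℝ be smooth doubly periodic functions with Λ > 0 everywhere, satisfying: a₀ − a₂ ≡ 4; (a₀Λ)_x = 0; (a₂Λ)_y = 0; Λ(a₀)_y + a₂Λ_y = 0; Λ(a₂)_x + a₀Λ_x = 0; 2Λf_x + Λ_x f − Λ_y g = 0; f_x + g_y = 0; Ω = (1/4)(g_x − f_y); (c₀)_x = −(1/2)g(g_x − f_y); (c₀)_y = −(1/2)f(g_x − f_y). If Ω is not identically zero, then either (f ≡ 0, Λ_y ≡ 0 and g_y ≡ 0, so that Λ and g depend only on x and Ω = (1/4)g_x depends only on x), or (g ≡ 0, Λ_x ≡ 0 and f_x ≡ 0, so that Λ and f depend only on y and Ω = −(1/4)f_y depends only on y). -/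
open Set

theorem hasDerivAt_pX {h : ℝ × ℝ → ℝ} (hh : Differentiable ℝ h) (x y : ℝ) :
    HasDerivAt (fun t => h (t, y)) (pX h (x, y)) x :=
  (hh (x, y)).hasFDerivAt.comp_hasDerivAt x ((hasDerivAt_id x).prodMk (hasDerivAt_const x y))

theorem hasDerivAt_pY {h : ℝ × ℝ → ℝ} (hh : Differentiable ℝ h) (x y : ℝ) :
    HasDerivAt (fun t => h (x, t)) (pY h (x, y)) y :=
  (hh (x, y)).hasFDerivAt.comp_hasDerivAt y ((hasDerivAt_const y x).prodMk (hasDerivAt_id y))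

theorem eq_of_pX_eq_zero {h : ℝ × ℝ → ℝ} (hh : Differentiable ℝ h) (h0 : ∀ p, pX h p = 0)
    (x x' y : ℝ) : h (x, y) = h (x', y) :=
  is_const_of_deriv_eq_zero (f := fun t => h (t, y))
    (fun t => (hasDerivAt_pX hh t y).differentiableAt)
    (fun t => by rw [(hasDerivAt_pX hh t y).deriv, h0]) x x'

theorem eq_of_pY_eq_zero {h : ℝ × ℝ → ℝ} (hh : Differentiable ℝ h) (h0 : ∀ p, pY h p = 0)
    (x y y' : ℝ) : h (x, y) = h (x, y') :=
  is_const_of_deriv_eq_zero (f := fun t => h (x, t))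
    (fun t => (hasDerivAt_pY hh x t).differentiableAt)
    (fun t => by rw [(hasDerivAt_pY hh x t).deriv, h0]) y y'

theorem pX_eq_zero_of_eq {h : ℝ × ℝ → ℝ} (hh : Differentiable ℝ h)
    (hc : ∀ x x' y, h (x, y) = h (x', y)) (p : ℝ × ℝ) : pX h p = 0 := by
  refine (hasDerivAt_pX hh p.1 p.2).unique ?_
  simpa only [hc _ 0] using hasDerivAt_const p.1 (h (0, p.2))

theorem pY_eq_zero_of_eq {h : ℝ × ℝ → ℝ} (hh : Differentiable ℝ h)
    (hc : ∀ x y y', h (x, y) = h (x, y')) (p : ℝ × ℝ) : pY h p = 0 := by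
  refine (hasDerivAt_pY hh p.1 p.2).unique ?_
  simpa only [hc _ _ 0] using hasDerivAt_const p.2 (h (p.1, 0))

theorem pX_eq_pX_of_eq {h : ℝ × ℝ → ℝ} (hh : Differentiable ℝ h)
    (hc : ∀ x y y', h (x, y) = h (x, y')) (x y y' : ℝ) : pX h (x, y) = pX h (x, y') := by
  refine (hasDerivAt_pX hh x y).unique ?_
  simpa only [hc _ y y'] using hasDerivAt_pX hh x y'

theorem pY_eq_pY_of_eq {h : ℝ × ℝ → ℝ} (hh : Differentiable ℝ h)
    (hc : ∀ x x' y, h (x, y) = h (x', y)) (x x' y : ℝ) : pY h (x, y) = pY h (x', y) := by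
  refine (hasDerivAt_pY hh x y).unique ?_
  simpa only [hc x x'] using hasDerivAt_pY hh x' y

theorem pX_mul_s8 {u v : ℝ × ℝ → ℝ} (hu : Differentiable ℝ u) (hv : Differentiable ℝ v)
    (p : ℝ × ℝ) : pX (fun q => u q * v q) p = pX u p * v p + u p * pX v p := by
  simp only [pX, fderiv_fun_mul (hu p) (hv p), add_apply,
    smul_apply, smul_eq_mul]
  ring

theorem pY_mul_s8 {u v : ℝ × ℝ → ℝ} (hu : Differentiable ℝ u) (hv : Differentiable ℝ v)
    (p : ℝ × ℝ) : pY (fun q => u q * v q) p = pY u p * v p + u p * pY v p := by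
  simp only [pY, fderiv_fun_mul (hu p) (hv p), add_apply,
    smul_apply, smul_eq_mul]
  ring

theorem pX_sub {u v : ℝ × ℝ → ℝ} (hu : Differentiable ℝ u) (hv : Differentiable ℝ v)
    (p : ℝ × ℝ) : pX (fun q => u q - v q) p = pX u p - pX v p := by
  simp [pX, fderiv_fun_sub (hu p) (hv p)]

theorem pY_sub {u v : ℝ × ℝ → ℝ} (hu : Differentiable ℝ u) (hv : Differentiable ℝ v)
    (p : ℝ × ℝ) : pY (fun q => u q - v q) p = pY u p - pY v p := by
  simp [pY, fderiv_fun_sub (hu p) (hv p)]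

theorem pX_add {u v : ℝ × ℝ → ℝ} (hu : Differentiable ℝ u) (hv : Differentiable ℝ v)
    (p : ℝ × ℝ) : pX (fun q => u q + v q) p = pX u p + pX v p := by
  simp [pX, fderiv_fun_add (hu p) (hv p)]

theorem pY_add {u v : ℝ × ℝ → ℝ} (hu : Differentiable ℝ u) (hv : Differentiable ℝ v)
    (p : ℝ × ℝ) : pY (fun q => u q + v q) p = pY u p + pY v p := by
  simp [pY, fderiv_fun_add (hu p) (hv p)]

/-- A continuous doubly periodic function is bounded. -/
theorem DoublyPeriodic.exists_abs_le {h : ℝ × ℝ → ℝ} (hp : DoublyPeriodic h)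
    (hc : Continuous h) : ∃ C, ∀ p, |h p| ≤ C := by
  obtain ⟨C, hC⟩ := (isCompact_Icc (a := ((0, 0) : ℝ × ℝ)) (b := (1, 1))).exists_bound_of_continuousOn
    hc.continuousOn
  refine ⟨C, fun p => ?_⟩
  have hx : h p = h (Int.fract p.1, p.2) := by
    have hper : Function.Periodic (fun t => h (t, p.2)) 1 := fun t => (hp t p.2).1
    simpa using (hper.sub_int_mul_eq ⌊p.1⌋ (x := p.1)).symm
  have hy : h (Int.fract p.1, p.2) = h (Int.fract p.1, Int.fract p.2) := by
    have hper : Function.Periodic (fun t => h (Int.fract p.1, t)) 1 :=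
      fun t => (hp (Int.fract p.1) t).2
    simpa using (hper.sub_int_mul_eq ⌊p.2⌋ (x := p.2)).symm
  rw [hx, hy, ← Real.norm_eq_abs]
  exact hC _ ⟨⟨Int.fract_nonneg _, Int.fract_nonneg _⟩,
    ⟨(Int.fract_lt_one _).le, (Int.fract_lt_one _).le⟩⟩

/-- Doubly periodic solutions of the Cauchy-Riemann equations are constant. -/
theorem eq_of_cauchyRiemann_of_doublyPeriodic {u v : ℝ × ℝ → ℝ}
    (hu : Differentiable ℝ u) (hv : Differentiable ℝ v)
    (hup : DoublyPeriodic u) (hvp : DoublyPeriodic v)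
    (hx : ∀ p, pX u p = pY v p) (hy : ∀ p, pY u p = -pX v p) (p q : ℝ × ℝ) : v p = v q := by
  let L : ℂ →L[ℝ] ℝ × ℝ := Complex.reCLM.prod Complex.imCLM
  let F : ℂ → ℂ := fun z => (u (L z) : ℂ) + (v (L z) : ℂ) * Complex.I
  have hF : Differentiable ℂ F := fun z => by
    have hu' := ((hu (L z)).hasFDerivAt.comp z L.hasFDerivAt)
    have hv' := ((hv (L z)).hasFDerivAt.comp z L.hasFDerivAt)
    have hF' : HasFDerivAt F _ z :=
      (Complex.ofRealCLM.hasFDerivAt.comp z hu').add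
        ((Complex.ofRealCLM.hasFDerivAt.comp z hv').mul_const Complex.I)
    refine differentiableAt_complex_iff_differentiableAt_real.2 ⟨hF'.differentiableAt, ?_⟩
    have e1 := hx (L z)
    have e2 := hy (L z)
    simp only [pX, pY] at e1 e2
    rw [hF'.fderiv]
    apply Complex.ext <;> simp [L] at e1 e2 ⊢ <;> linarith
  obtain ⟨A, hA⟩ := hup.exists_abs_le hu.continuous
  obtain ⟨B, hB⟩ := hvp.exists_abs_le hv.continuous
  have hb : Bornology.IsBounded (range F) := by
    refine isBounded_iff_forall_norm_le.2 ⟨A + B, ?_⟩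
    rintro _ ⟨z, rfl⟩
    refine (norm_add_le _ _).trans (add_le_add ?_ ?_)
    · simpa using hA (L z)
    · simpa using hB (L z)
  have := congrArg Complex.im (hF.apply_eq_apply_of_bounded hb ⟨p.1, p.2⟩ ⟨q.1, q.2⟩)
  simpa [F, L] using this

/-- The compatibility of the equations for `c` makes `f * g` harmonic, hence constant. -/
theorem mul_eq_mul_of_doublyPeriodic {f g c : ℝ × ℝ → ℝ}
    (hf : Differentiable ℝ f) (hg : Differentiable ℝ g) (hc : Differentiable ℝ c)
    (hfp : DoublyPeriodic f) (hgp : DoublyPeriodic g) (hcp : DoublyPeriodic c)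
    (hdiv : ∀ p, pX f p + pY g p = 0)
    (hcx : ∀ p, pX c p = -(1/2) * g p * (pX g p - pY f p))
    (hcy : ∀ p, pY c p = -(1/2) * f p * (pX g p - pY f p)) (p q : ℝ × ℝ) :
    f p * g p = f q * g q := by
  refine eq_of_cauchyRiemann_of_doublyPeriodic
    (u := fun q => (g q * g q - f q * f q) + (4 * c q))
    (v := fun q => 2 * (f q * g q)) (by fun_prop) (by fun_prop) ?_ ?_ ?_ ?_ p q
      |> mul_left_cancel₀ two_ne_zero
  · intro x y
    simp only [(hfp x y).1, (hfp x y).2, (hgp x y).1, (hgp x y).2, (hcp x y).1, (hcp x y).2,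
      and_self]
  · intro x y
    simp only [(hfp x y).1, (hfp x y).2, (hgp x y).1, (hgp x y).2, and_self]
  all_goals
    intro p
    have hconst : ∀ a : ℝ, Differentiable ℝ fun _ : ℝ × ℝ => a := differentiable_const
    have hX : ∀ a : ℝ, pX (fun _ => a) p = 0 := fun a => by simp [pX]
    have hY : ∀ a : ℝ, pY (fun _ => a) p = 0 := fun a => by simp [pY]
    have hgg : Differentiable ℝ fun q => g q * g q := hg.mul hg
    have hff : Differentiable ℝ fun q => f q * f q := hf.mul hf
    have hfg : Differentiable ℝ fun q => f q * g q := hf.mul hg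
    have hD : Differentiable ℝ fun q => g q * g q - f q * f q := hgg.sub hff
    have h4c : Differentiable ℝ fun q => 4 * c q := (hconst 4).mul hc
    have e0 := hdiv p
    have e1 := hcx p
    have e2 := hcy p
    simp only [pX_add hD h4c, pY_add hD h4c, pX_sub hgg hff, pY_sub hgg hff, pX_mul_s8 hg hg,
      pY_mul_s8 hg hg, pX_mul_s8 hf hf, pY_mul_s8 hf hf, pX_mul_s8 hf hg, pY_mul_s8 hf hg, pX_mul_s8 (hconst _) hc,
      pY_mul_s8 (hconst _) hc, pX_mul_s8 (hconst _) hfg, pY_mul_s8 (hconst _) hfg, hX, hY, e1, e2]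
  · linear_combination -2 * f p * e0
  · linear_combination 2 * g p * e0

/-- A periodic function on a line with constant derivative has zero derivative. -/
theorem eq_zero_of_hasDerivAt_const_of_periodic {φ : ℝ → ℝ} {m : ℝ}
    (hφ : ∀ x, HasDerivAt φ m x) (hp : φ 1 = φ 0) : m = 0 := by
  have hd : ∀ x, HasDerivAt (fun t => φ t - t * m) 0 x := fun x => by
    simpa only [one_mul, sub_self] using (hφ x).fun_sub ((hasDerivAt_id' x).mul_const m)
  have := is_const_of_deriv_eq_zero (fun x => (hd x).differentiableAt) (fun x => (hd x).deriv) 1 0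
  simp only [hp] at this
  linarith

/-- (Theorem 2 of the paper.) If the magnetic geodesic flow of
`ds² = Λ(dx² + dy²)` with magnetic form `Ω dx∧dy ≠ 0` admits a quadratic in momenta
integral `F = a₀p₁² + a₂p₂² + 2f p₁ - 2g p₂ + c₀` on all energy levels (normalized with
`a₁ ≡ 0`, `a₀ - a₂ ≡ 4`), then either `Λ, g, Ω` depend only on `x` and `f ≡ 0`, or
`Λ, f, Ω` depend only on `y` and `g ≡ 0`; i.e. the flow is of the form of Example 1,
with a linear in momenta integral. -/
theorem statement8
    (Λ a₀ a₂ f g c₀ Ω : ℝ × ℝ → ℝ)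
    (hΛ : ContDiff ℝ (⊤ : ℕ∞) Λ) (ha₀ : ContDiff ℝ (⊤ : ℕ∞) a₀) (ha₂ : ContDiff ℝ (⊤ : ℕ∞) a₂)
    (hf : ContDiff ℝ (⊤ : ℕ∞) f) (hg : ContDiff ℝ (⊤ : ℕ∞) g) (hc₀ : ContDiff ℝ (⊤ : ℕ∞) c₀)
    (hΩ : ContDiff ℝ (⊤ : ℕ∞) Ω)
    (hΛper : DoublyPeriodic Λ) (ha₀per : DoublyPeriodic a₀) (ha₂per : DoublyPeriodic a₂)
    (hfper : DoublyPeriodic f) (hgper : DoublyPeriodic g) (hc₀per : DoublyPeriodic c₀)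
    (hΩper : DoublyPeriodic Ω)
    (hΛpos : ∀ p : ℝ × ℝ, 0 < Λ p)
    (hnorm : ∀ p : ℝ × ℝ, a₀ p - a₂ p = 4)
    (h1 : ∀ p : ℝ × ℝ, pX (fun q => a₀ q * Λ q) p = 0)
    (h2 : ∀ p : ℝ × ℝ, pY (fun q => a₂ q * Λ q) p = 0)
    (h3 : ∀ p : ℝ × ℝ, Λ p * pY a₀ p + a₂ p * pY Λ p = 0)
    (h4 : ∀ p : ℝ × ℝ, Λ p * pX a₂ p + a₀ p * pX Λ p = 0)
    (h5 : ∀ p : ℝ × ℝ, 2 * Λ p * pX f p + pX Λ p * f p - pY Λ p * g p = 0)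
    (h6 : ∀ p : ℝ × ℝ, pX f p + pY g p = 0)
    (h7 : ∀ p : ℝ × ℝ, Ω p = (1/4) * (pX g p - pY f p))
    (h8 : ∀ p : ℝ × ℝ, pX c₀ p = -(1/2) * g p * (pX g p - pY f p))
    (h9 : ∀ p : ℝ × ℝ, pY c₀ p = -(1/2) * f p * (pX g p - pY f p))
    (hΩne : ∃ p : ℝ × ℝ, Ω p ≠ 0) :
    ((∀ p : ℝ × ℝ, f p = 0) ∧ (∀ p : ℝ × ℝ, pY Λ p = 0) ∧ (∀ p : ℝ × ℝ, pY g p = 0) ∧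
      (∀ x y y' : ℝ, Λ (x, y) = Λ (x, y') ∧ g (x, y) = g (x, y') ∧ Ω (x, y) = Ω (x, y')) ∧
      (∀ p : ℝ × ℝ, Ω p = (1/4) * pX g p)) ∨
    ((∀ p : ℝ × ℝ, g p = 0) ∧ (∀ p : ℝ × ℝ, pX Λ p = 0) ∧ (∀ p : ℝ × ℝ, pX f p = 0) ∧
      (∀ x x' y : ℝ, Λ (x, y) = Λ (x', y) ∧ f (x, y) = f (x', y) ∧ Ω (x, y) = Ω (x', y)) ∧
      (∀ p : ℝ × ℝ, Ω p = -(1/4) * pY f p)) := by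
  replace hΛ : Differentiable ℝ Λ := hΛ.differentiable (by simp)
  replace ha₀ : Differentiable ℝ a₀ := ha₀.differentiable (by simp)
  replace ha₂ : Differentiable ℝ a₂ := ha₂.differentiable (by simp)
  replace hf : Differentiable ℝ f := hf.differentiable (by simp)
  replace hg : Differentiable ℝ g := hg.differentiable (by simp)
  replace hc₀ : Differentiable ℝ c₀ := hc₀.differentiable (by simp)
  have hfg := mul_eq_mul_of_doublyPeriodic hf hg hc₀ hfper hgper hc₀per h6 h8 h9
  have hα : Differentiable ℝ fun q => a₀ q * Λ q := ha₀.mul hΛ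
  have hβ : Differentiable ℝ fun q => a₂ q * Λ q := ha₂.mul hΛ
  have hΛeq : (fun q => a₀ q * Λ q - a₂ q * Λ q) = fun q => 4 * Λ q := by
    funext q
    linear_combination Λ q * hnorm q
  have hΛX : ∀ p, 4 * pX Λ p = -pX (fun q => a₂ q * Λ q) p := fun p => by
    have e := pX_sub hα hβ p
    rw [hΛeq, pX_mul_s8 (differentiable_const _) hΛ, h1] at e
    simpa [pX] using e
  have hΛY : ∀ p, 4 * pY Λ p = pY (fun q => a₀ q * Λ q) p := fun p => by
    have e := pY_sub hα hβ p
    rw [hΛeq, pY_mul_s8 (differentiable_const _) hΛ, h2] at e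
    simpa [pY] using e
  have hΛX' : ∀ x y y', pX Λ (x, y) = pX Λ (x, y') := fun x y y' => by
    have := pX_eq_pX_of_eq hβ (eq_of_pY_eq_zero hβ h2) x y y'
    linarith [hΛX (x, y), hΛX (x, y')]
  have hΛY' : ∀ x x' y, pY Λ (x, y) = pY Λ (x', y) := fun x x' y => by
    have := pY_eq_pY_of_eq hα (eq_of_pX_eq_zero hα h1) x x' y
    linarith [hΛY (x, y), hΛY (x', y)]
  have hff : Differentiable ℝ fun q => f q * f q := hf.mul hf
  have hgg : Differentiable ℝ fun q => g q * g q := hg.mul hg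
  have hA : Differentiable ℝ fun q => Λ q * (f q * f q) := hΛ.mul hff
  have hB : Differentiable ℝ fun q => Λ q * (g q * g q) := hΛ.mul hgg
  have hAX : ∀ p, pX (fun q => Λ q * (f q * f q)) p = pY Λ p * (f p * g p) := fun p => by
    rw [pX_mul_s8 hΛ hff, pX_mul_s8 hf hf]
    linear_combination f p * h5 p
  have hBY : ∀ p, pY (fun q => Λ q * (g q * g q)) p = pX Λ p * (f p * g p) := fun p => by
    rw [pY_mul_s8 hΛ hgg, pY_mul_s8 hg hg]
    linear_combination -g p * h5 p + 2 * Λ p * g p * h6 p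
  have hAX0 : ∀ p, pY Λ p * (f p * g p) = 0 := fun ⟨x, y⟩ => by
    refine eq_zero_of_hasDerivAt_const_of_periodic
      (φ := fun t => Λ (t, y) * (f (t, y) * f (t, y))) (fun t => ?_) ?_
    · have e := hasDerivAt_pX hA t y
      rwa [hAX, hΛY' t x, hfg (t, y) (x, y)] at e
    · have e1 := (hΛper 0 y).1
      have e2 := (hfper 0 y).1
      rw [zero_add] at e1 e2
      simp only [e1, e2]
  have hBY0 : ∀ p, pX Λ p * (f p * g p) = 0 := fun ⟨x, y⟩ => by
    refine eq_zero_of_hasDerivAt_const_of_periodic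
      (φ := fun t => Λ (x, t) * (g (x, t) * g (x, t))) (fun t => ?_) ?_
    · have e := hasDerivAt_pY hB x t
      rwa [hBY, hΛX' x t y, hfg (x, t) (x, y)] at e
    · have e1 := (hΛper x 0).2
      have e2 := (hgper x 0).2
      rw [zero_add] at e1 e2
      simp only [e1, e2]
  have hAc := eq_of_pX_eq_zero hA fun p => (hAX p).trans (hAX0 p)
  have hBc := eq_of_pY_eq_zero hB fun p => (hBY p).trans (hBY0 p)
  have hfg0 : ∀ p, f p * g p = 0 := by
    intro p₀
    by_contra hk
    have hne : ∀ p, f p * g p ≠ 0 := fun p => hfg p p₀ ▸ hk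
    have hfX : ∀ p, pX f p = 0 := fun p => by
      have e1 := (mul_eq_zero.1 (hAX0 p)).resolve_right (hne p)
      have e2 := (mul_eq_zero.1 (hBY0 p)).resolve_right (hne p)
      have e := h5 p
      rw [e1, e2] at e
      have : Λ p * pX f p = 0 := by linarith
      exact (mul_eq_zero.1 this).resolve_left (hΛpos p).ne'
    have hgY : ∀ p, pY g p = 0 := fun p => by linarith [h6 p, hfX p]
    have hfY : ∀ p, pY f p = 0 := pY_eq_zero_of_eq hf fun x y y' => by
      have e := hfg (x, y) (x, y')
      rw [eq_of_pY_eq_zero hg hgY x y y'] at e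
      exact mul_right_cancel₀ (right_ne_zero_of_mul (hne (x, y'))) e
    have hgX : ∀ p, pX g p = 0 := pX_eq_zero_of_eq hg fun x x' y => by
      have e := hfg (x, y) (x', y)
      rw [eq_of_pX_eq_zero hf hfX x x' y] at e
      exact mul_left_cancel₀ (left_ne_zero_of_mul (hne (x', y))) e
    obtain ⟨p, hp⟩ := hΩne
    exact hp (by rw [h7, hgX, hfY]; ring)
  by_cases hf0 : ∀ p, f p = 0
  · left
    have hfX := pX_eq_zero_of_eq hf fun x x' y => by rw [hf0, hf0]
    have hfY := pY_eq_zero_of_eq hf fun x y y' => by rw [hf0, hf0]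
    have hgY : ∀ p, pY g p = 0 := fun p => by linarith [h6 p, hfX p]
    have hgc := eq_of_pY_eq_zero hg hgY
    have hΩg : ∀ p, Ω p = 1 / 4 * pX g p := fun p => by rw [h7, hfY, sub_zero]
    obtain ⟨⟨x₀, y₀⟩, hg0⟩ : ∃ p, g p ≠ 0 := by
      by_contra! hg0
      obtain ⟨p, hp⟩ := hΩne
      refine hp ?_
      rw [hΩg, pX_eq_zero_of_eq hg fun x x' y => by rw [hg0, hg0], mul_zero]
    have hΛ0 : ∀ p, pY Λ p = 0 := fun ⟨x, y⟩ => by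
      have e := h5 (x₀, y)
      rw [hfX, hf0, hgc x₀ y y₀] at e
      rw [hΛY' x x₀]
      refine (mul_eq_zero.1 ?_).resolve_right hg0
      linarith
    refine ⟨hf0, hΛ0, hgY, fun x y y' => ⟨eq_of_pY_eq_zero hΛ hΛ0 x y y', hgc x y y', ?_⟩, hΩg⟩
    rw [hΩg, hΩg, pX_eq_pX_of_eq hg hgc x y y']
  · right
    push Not at hf0
    obtain ⟨⟨x₀, y₀⟩, hf0⟩ := hf0
    have hg0 : ∀ p, g p = 0 := fun ⟨x, y⟩ => by
      have hfx : f (x, y₀) ≠ 0 := fun h0 => by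
        have e := hAc x₀ x y₀
        simp [h0, hf0, (hΛpos _).ne'] at e
      have hgx : g (x, y₀) = 0 := (mul_eq_zero.1 (hfg0 (x, y₀))).resolve_left hfx
      have e := hBc x y y₀
      simpa [hgx, (hΛpos _).ne'] using e
    have hgX := pX_eq_zero_of_eq hg fun x x' y => by rw [hg0, hg0]
    have hgY := pY_eq_zero_of_eq hg fun x y y' => by rw [hg0, hg0]
    have hfX : ∀ p, pX f p = 0 := fun p => by linarith [h6 p, hgY p]
    have hfc := eq_of_pX_eq_zero hf hfX
    have hΩf : ∀ p, Ω p = -(1 / 4) * pY f p := fun p => by rw [h7, hgX]; ring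
    have hΛ0 : ∀ p, pX Λ p = 0 := fun ⟨x, y⟩ => by
      have e := h5 (x, y₀)
      rw [hfX, hg0, hfc x x₀ y₀] at e
      rw [hΛX' x y y₀]
      refine (mul_eq_zero.1 ?_).resolve_right hf0
      linarith
    refine ⟨hg0, hΛ0, hfX, fun x x' y => ⟨eq_of_pX_eq_zero hΛ hΛ0 x x' y, hfc x x' y, ?_⟩, hΩf⟩
    rw [hΩf, hΩf, pY_eq_pY_of_eq hf hfc x x' y]
end

section
/- Let f, g, c₀: ℝ² → ℝ be continuously differentiable doubly periodic functions satisfying f_x + g_y = 0, (c₀)_x = −(1/2)g(g_x − f_y), and (c₀)_y = −(1/2)f(g_x − f_y). Then the function c₀ + (g² − f²)/4 is constant and the function f·g is constant on ℝ². -/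
open Set

/-- A continuous doubly periodic function is bounded. -/
theorem DoublyPeriodic.exists_bound {h : ℝ × ℝ → ℝ} (hper : DoublyPeriodic h)
    (hcont : Continuous h) : ∃ C : ℝ, ∀ p, ‖h p‖ ≤ C := by
  obtain ⟨C, hC⟩ := (isCompact_Icc.prod isCompact_Icc :
    IsCompact (Icc (0 : ℝ) 1 ×ˢ Icc (0 : ℝ) 1)).exists_bound_of_continuousOn hcont.continuousOn
  refine ⟨C, fun ⟨x, y⟩ => ?_⟩
  have hx : Function.Periodic (fun t => h (t, y)) 1 := fun t => (hper t y).1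
  have hy : Function.Periodic (fun t => h (Int.fract x, t)) 1 := fun t => (hper _ t).2
  have key : h (x, y) = h (Int.fract x, Int.fract y) := by
    have h1 := hx.sub_zsmul_eq (x := x) ⌊x⌋
    have h2 := hy.sub_zsmul_eq (x := y) ⌊y⌋
    simp only [zsmul_eq_mul, mul_one, Int.self_sub_floor] at h1 h2
    rw [h2, h1]
  rw [key]
  exact hC _ ⟨⟨Int.fract_nonneg _, (Int.fract_lt_one _).le⟩,
    ⟨Int.fract_nonneg _, (Int.fract_lt_one _).le⟩⟩

/-- Bounded differentiable solutions of the Cauchy–Riemann equations on the plane are constant. -/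
theorem eq_of_cauchyRiemann_of_bounded {u v : ℝ × ℝ → ℝ} (hu : Differentiable ℝ u)
    (hv : Differentiable ℝ v) (hux : ∀ p, pX u p = pY v p) (huy : ∀ p, pY u p = -pX v p)
    (hub : ∃ C : ℝ, ∀ p, ‖u p‖ ≤ C) (hvb : ∃ C : ℝ, ∀ p, ‖v p‖ ≤ C) (p q : ℝ × ℝ) :
    u p = u q ∧ v p = v q := by
  let e := Complex.equivRealProdCLM
  let F : ℂ → ℂ := fun z => (u (e z) : ℂ) + (v (e z) : ℂ) * Complex.I
  have hF : Differentiable ℂ F := fun z => by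
    have hu' := Complex.ofRealCLM.hasFDerivAt.comp z
      ((hu (e z)).hasFDerivAt.comp z e.hasFDerivAt)
    have hv' := Complex.ofRealCLM.hasFDerivAt.comp z
      ((hv (e z)).hasFDerivAt.comp z e.hasFDerivAt)
    refine ((hu'.add (hv'.mul_const Complex.I)).complexOfReal_hasFDerivAt ?_).differentiableAt
    have h1 := hux (e z)
    have h2 := huy (e z)
    have he1 : e 1 = (1, 0) := by simp [e]
    have heI : e Complex.I = (0, 1) := by simp [e]
    simp only [pX, pY, ← he1, ← heI] at h1 h2
    apply Complex.ext
    · simpa using h2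
    · simpa using h1.symm
  obtain ⟨A, hA⟩ := hub
  obtain ⟨B, hB⟩ := hvb
  have hFb : Bornology.IsBounded (range F) := by
    refine isBounded_iff_forall_norm_le.2 ⟨A + B, ?_⟩
    rintro _ ⟨z, rfl⟩
    refine (norm_add_le _ _).trans (add_le_add ?_ ?_)
    · simpa using hA (e z)
    · simpa using hB (e z)
  have h := hF.apply_eq_apply_of_bounded hFb (e.symm p) (e.symm q)
  simp only [F, e.apply_symm_apply] at h
  exact ⟨by simpa using congrArg Complex.re h, by simpa using congrArg Complex.im h⟩

/-- The group (c) of equations on the zero-order coefficient `c₀`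
together with `f_x + g_y = 0` implies that `c₀ + (g² - f²)/4` and `f·g` are constant. -/
theorem statement11
    (f g c₀ : ℝ × ℝ → ℝ)
    (hf : ContDiff ℝ 1 f) (hg : ContDiff ℝ 1 g) (hc₀ : ContDiff ℝ 1 c₀)
    (hfper : DoublyPeriodic f) (hgper : DoublyPeriodic g) (hc₀per : DoublyPeriodic c₀)
    (h1 : ∀ p : ℝ × ℝ, pX f p + pY g p = 0)
    (h2 : ∀ p : ℝ × ℝ, pX c₀ p = -(1/2) * g p * (pX g p - pY f p))
    (h3 : ∀ p : ℝ × ℝ, pY c₀ p = -(1/2) * f p * (pX g p - pY f p)) :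
    (∃ c : ℝ, ∀ p : ℝ × ℝ, c₀ p + (g p ^ 2 - f p ^ 2) / 4 = c) ∧
    (∃ c : ℝ, ∀ p : ℝ × ℝ, f p * g p = c) := by
  have df := hf.differentiable one_ne_zero
  have dg := hg.differentiable one_ne_zero
  have dc := hc₀.differentiable one_ne_zero
  set u : ℝ × ℝ → ℝ := fun p => c₀ p + (g p ^ 2 - f p ^ 2) * (1 / 4) with hu
  set v : ℝ × ℝ → ℝ := fun p => f p * g p * (1 / 2) with hv
  have hu' : ∀ p, HasFDerivAt u _ p := fun p =>
    (dc p).hasFDerivAt.add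
      ((((dg p).hasFDerivAt.pow 2).sub ((df p).hasFDerivAt.pow 2)).mul_const (1 / 4))
  have hv' : ∀ p, HasFDerivAt v _ p := fun p =>
    ((df p).hasFDerivAt.mul (dg p).hasFDerivAt).mul_const (1 / 2)
  have huper : DoublyPeriodic u := fun x y => by
    simp [hu, hfper x y, hgper x y, hc₀per x y]
  have hvper : DoublyPeriodic v := fun x y => by
    simp [hv, hfper x y, hgper x y]
  have du : Differentiable ℝ u := fun p => (hu' p).differentiableAt
  have dv : Differentiable ℝ v := fun p => (hv' p).differentiableAt
  simp only [pX, pY] at h1 h2 h3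
  have key := eq_of_cauchyRiemann_of_bounded du dv
    (fun p => by
      simp [pX, pY, (hu' p).fderiv, (hv' p).fderiv]
      linear_combination h2 p - f p / 2 * h1 p)
    (fun p => by
      simp [pX, pY, (hu' p).fderiv, (hv' p).fderiv]
      linear_combination h3 p + g p / 2 * h1 p)
    (huper.exists_bound du.continuous) (hvper.exists_bound dv.continuous)
  refine ⟨⟨u 0, fun p => ?_⟩, ⟨2 * v 0, fun p => ?_⟩⟩
  · rw [← (key p 0).1]
    simp only [hu]
    ring
  · rw [← (key p 0).2]
    simp only [hv]
    ring
end

section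
/- Let Λ, f, g: ℝ² → ℝ be continuously differentiable with Λ > 0 everywhere, satisfying 2Λf_x + Λ_x f − Λ_y g = 0 and f_x + g_y = 0. Then the identities (f²Λ)_x = f·g·Λ_y and (g²Λ)_y = f·g·Λ_x hold on all of ℝ². -/
open Set

/-- The derivative of `u² w` in the direction `v`. -/
theorem fderiv_sq_mul_apply {E : Type*} [NormedAddCommGroup E] [NormedSpace ℝ E]
    {u w : E → ℝ} {p : E} (hu : DifferentiableAt ℝ u p) (hw : DifferentiableAt ℝ w p) (v : E) :
    fderiv ℝ (fun q => u q ^ 2 * w q) p v =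
      2 * u p * w p * fderiv ℝ u p v + u p ^ 2 * fderiv ℝ w p v := by
  have h := (hu.hasFDerivAt.pow 2).mul hw.hasFDerivAt
  have h' : HasFDerivAt (fun q => u q ^ 2 * w q) _ p := h
  rw [h'.fderiv]
  simp
  ring

/-- The key computation of Theorem 2: equations (b1'), (b2') imply
`(f²Λ)_x = f g Λ_y` and `(g²Λ)_y = f g Λ_x`. -/
theorem statement12
    (Λ f g : ℝ × ℝ → ℝ)
    (hΛ : ContDiff ℝ 1 Λ) (hf : ContDiff ℝ 1 f) (hg : ContDiff ℝ 1 g)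
    (hΛpos : ∀ p : ℝ × ℝ, 0 < Λ p)
    (hb1 : ∀ p : ℝ × ℝ, 2 * Λ p * pX f p + pX Λ p * f p - pY Λ p * g p = 0)
    (hb2 : ∀ p : ℝ × ℝ, pX f p + pY g p = 0) :
    (∀ p : ℝ × ℝ, pX (fun q => f q ^ 2 * Λ q) p = f p * g p * pY Λ p) ∧
    (∀ p : ℝ × ℝ, pY (fun q => g q ^ 2 * Λ q) p = f p * g p * pX Λ p) := by
  have hΛd : Differentiable ℝ Λ := hΛ.differentiable one_ne_zero
  refine ⟨fun p => ?_, fun p => ?_⟩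
  · have h := fderiv_sq_mul_apply (hf.differentiable one_ne_zero p) (hΛd p) (1, 0)
    unfold pX pY at *
    linear_combination h + f p * hb1 p
  · have h := fderiv_sq_mul_apply (hg.differentiable one_ne_zero p) (hΛd p) (0, 1)
    unfold pX pY at *
    linear_combination h - g p * hb1 p + 2 * g p * Λ p * hb2 p
end
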